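/- arXiv:math/0611673 — 2 statements merged into one kernel-verified Lean document; each statement's English description precedes it below -/
import Mathlib

section
/- Let K be an arbitrary field. Then ed_K(S₂) = ed_K(S₃) = 1 and ed_K(S₄) = ed_K(S₅) = 2. Moreover, if char K ≠ 2, then ed_K(S₆) = 3. -/
noncomputable section

/-- The transcendence degree of `L` over `K`: the supremum of the cardinalities of
algebraically independent subsets of `L`. -/
noncomputable def trdeg (K L : Type*) [CommRing K] [CommRing L] [Algebra K L] : Cardinal :=
  ⨆ s : {s : Set L // AlgebraicIndependent K ((↑) : s → L)}, Cardinal.mk s.1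

/-- The rational function field over `K` on variables indexed by `σ` :
the fraction field of the polynomial ring `K[x_i : i ∈ σ]`. -/
abbrev FnField (K : Type*) [Field K] (σ : Type*) : Type _ :=
  FractionRing (MvPolynomial σ K)

/-- Permutations of the variables acting on the polynomial ring by `K`-algebra
automorphisms. -/
noncomputable def permHom (K : Type*) [Field K] (σ : Type*) :
    Equiv.Perm σ →* (MvPolynomial σ K ≃ₐ[K] MvPolynomial σ K) where
  toFun e := MvPolynomial.renameEquiv K e
  map_one' := MvPolynomial.renameEquiv_refl K
  map_mul' e f := by
    ext x
    simp [MvPolynomial.renameEquiv, Equiv.Perm.mul_apply]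

/-- Permutations of the variables acting on the rational function field by
`K`-algebra automorphisms. -/
noncomputable def permGalAction (K : Type*) [Field K] (σ : Type*) :
    Equiv.Perm σ →* (FnField K σ ≃ₐ[K] FnField K σ) :=
  (IsFractionRing.fieldEquivOfAlgEquivHom K (FnField K σ)).comp (permHom K σ)

/-- The action of a group `G` on its rational function field `K(x_g : g ∈ G)` by
`K`-algebra automorphisms, permuting the variables by left translation:
`σ • x_g = x_{σg}`. -/
noncomputable def galAction (K : Type*) [Field K] (G : Type*) [Group G] :
    G →* (FnField K G ≃ₐ[K] FnField K G) :=
  (permGalAction K G).comp (MulAction.toPermHom G G)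

/-- The essential dimension of a group `G` over the field `K`:
the minimum of the transcendence degrees over `K` of the `G`-stable intermediate
subfields of the rational function field `K(x_g : g ∈ G)` on which `G` acts
faithfully. -/
noncomputable def edK (K : Type*) [Field K] (G : Type*) [Group G] : ℕ :=
  sInf { d : ℕ | ∃ E : IntermediateField K (FnField K G),
    (∀ g : G, ∀ x ∈ E, galAction K G g x ∈ E) ∧
    (∀ g : G, g ≠ 1 → ∃ x ∈ E, galAction K G g x ≠ x) ∧
    trdeg K E = d }

open MvPolynomial

lemma sum_ne_zero_of_injOn_degree {σ K ι : Type*} [Field K] (m : MonomialOrder σ)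
    {s : Finset ι} (hs : s.Nonempty) {F : ι → MvPolynomial σ K} (h0 : ∀ i ∈ s, F i ≠ 0)
    (hinj : Set.InjOn (fun i ↦ m.degree (F i)) s) : ∑ i ∈ s, F i ≠ 0 := by
  classical
  obtain ⟨i₀, hi₀, hmax⟩ := s.exists_max_image (fun i ↦ m.toSyn (m.degree (F i))) hs
  intro hsum
  have hc : (∑ i ∈ s, F i).coeff (m.degree (F i₀)) = (F i₀).coeff (m.degree (F i₀)) := by
    rw [coeff_sum]
    refine Finset.sum_eq_single_of_mem i₀ hi₀ fun i hi hne ↦ m.coeff_eq_zero_of_lt ?_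
    refine lt_of_le_of_ne (hmax i hi) fun h ↦ hne (hinj hi hi₀ ?_)
    exact m.toSyn.injective h
  rw [hsum, coeff_zero] at hc
  exact m.coeff_degree_ne_zero_iff.mpr (h0 i₀ hi₀) hc.symm

/-- Fractions whose monomial-order degrees are `ℤ`-linearly independent are algebraically
independent. -/
lemma algebraicIndependent_of_degree {σ K ι : Type*} [Field K] [Fintype ι] (m : MonomialOrder σ)
    (p : ι → MvPolynomial σ K) (q : MvPolynomial σ K) (hp : ∀ i, p i ≠ 0) (hq : q ≠ 0)
    (hlin : ∀ n : ι → ℤ, (∀ s, ∑ i, n i * ((m.degree (p i) s : ℤ) - m.degree q s) = 0) → n = 0) :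
    AlgebraicIndependent K fun i ↦
      algebraMap (MvPolynomial σ K) (FnField K σ) (p i) / algebraMap _ _ q := by
  rw [algebraicIndependent_iff]
  intro P hP
  by_contra hP0
  set D := P.totalDegree
  let F : (ι →₀ ℕ) → MvPolynomial σ K := fun a : ι →₀ ℕ ↦
    C (P.coeff a) * ((∏ i, p i ^ a i) * q ^ (D - a.degree))
  have hne : ∀ a : ι →₀ ℕ, (∏ i, p i ^ a i) * q ^ (D - a.degree) ≠ 0 := fun a ↦
    mul_ne_zero (Finset.prod_ne_zero_iff.mpr fun i _ ↦ pow_ne_zero _ (hp i)) (pow_ne_zero _ hq)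
  have hF0 : ∀ a ∈ P.support, F a ≠ 0 := fun a ha ↦
    mul_ne_zero (by simpa using ha) (hne a)
  have hle : ∀ a ∈ P.support, a.degree ≤ D := fun a ha ↦ le_totalDegree ha
  have hdeg : ∀ a ∈ P.support, ∀ s, (m.degree (F a) s : ℤ) =
      ∑ i, (a i : ℤ) * ((m.degree (p i) s : ℤ) - m.degree q s) + D * m.degree q s := by
    intro a ha s
    have hdeg' : (a.degree : ℤ) = ∑ i, (a i : ℤ) := by
      rw [Finsupp.degree_eq_sum]; push_cast; rfl
    have h1 : m.degree (F a) = ∑ i, a i • m.degree (p i) + (D - a.degree) • m.degree q := by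
      rw [m.degree_mul (by simpa using ha) (hne a), m.degree_C, zero_add,
        m.degree_mul (left_ne_zero_of_mul (hne a)) (right_ne_zero_of_mul (hne a)),
        m.degree_prod fun i _ ↦ pow_ne_zero _ (hp i)]
      simp [m.degree_pow]
    rw [h1]
    simp only [Finsupp.add_apply, Finsupp.smul_apply, Finsupp.finsetSum_apply, smul_eq_mul,
      mul_sub, Finset.sum_sub_distrib, ← Finset.sum_mul, ← hdeg']
    push_cast [Nat.cast_sub (hle a ha)]
    ring
  refine sum_ne_zero_of_injOn_degree m (F := F) (support_nonempty.mpr hP0) hF0 ?_ ?_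
  · intro a ha b hb hab
    have := hlin (fun i ↦ (a i : ℤ) - b i) fun s ↦ by
      have h1 := hdeg a ha s
      have h2 := hdeg b hb s
      simp only at hab
      rw [hab] at h1
      simp only [sub_mul (_ : ℤ) _ ((m.degree (p _) s : ℤ) - _), Finset.sum_sub_distrib]
      linarith
    ext i
    have := congrFun this i
    simp only [Pi.zero_apply] at this
    omega
  · apply IsFractionRing.injective (MvPolynomial σ K) (FnField K σ)
    rw [map_zero, map_sum]
    have hq' : algebraMap (MvPolynomial σ K) (FnField K σ) q ≠ 0 := by simpa using hq
    rw [aeval_def, eval₂_eq'] at hP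
    rw [← mul_zero (algebraMap (MvPolynomial σ K) (FnField K σ) q ^ D), ← hP, Finset.mul_sum]
    refine Finset.sum_congr rfl fun a ha ↦ ?_
    have hD : D = a.degree + (D - a.degree) := (Nat.add_sub_of_le (hle a ha)).symm
    simp only [F, map_mul, map_prod, map_pow, div_pow, Finset.prod_div_distrib]
    rw [Finset.prod_pow_eq_pow_sum, ← Finsupp.degree_eq_sum]
    conv_rhs => rw [hD, pow_add]
    rw [← algebraMap_eq, ← IsScalarTower.algebraMap_apply]
    field_simp

lemma prod_zpow_eq_zpow_sum {ι G : Type*} [CommGroup G] (s : Finset ι) (u : G) (f : ι → ℤ) :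
    ∏ i ∈ s, u ^ f i = u ^ ∑ i ∈ s, f i := by
  classical
  induction s using Finset.induction_on with
  | empty => simp
  | insert a s ha ih => rw [Finset.prod_insert ha, Finset.sum_insert ha, ih, zpow_add]

/-- The algebra endomorphism of a polynomial ring rescaling each variable by a sign. -/
def signTwist {σ : Type*} (K : Type*) [Field K] (ε : σ → ℤˣ) :
    MvPolynomial σ K →ₐ[K] MvPolynomial σ K :=
  aeval fun s ↦ (((ε s : ℤˣ) : ℤ) : K) • X s

lemma coeff_signTwist {σ K : Type*} [Field K] (ε : σ → ℤˣ) (p : MvPolynomial σ K) (d : σ →₀ ℕ) :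
    (signTwist K ε p).coeff d = (((d.prod fun s k ↦ ε s ^ k : ℤˣ) : ℤ) : K) * p.coeff d := by
  classical
  induction p using MvPolynomial.induction_on' with
  | monomial u a =>
    have h : signTwist K ε (monomial u a) =
        monomial u ((((u.prod fun s k ↦ ε s ^ k : ℤˣ) : ℤ) : K) * a) := by
      rw [signTwist, aeval_monomial, monomial_eq (s := u) (a := _ * a), algebraMap_eq, map_mul]
      simp only [smul_eq_C_mul, mul_pow, Finsupp.prod_mul]
      simp only [Finsupp.prod, Units.coe_prod, Int.cast_prod, map_prod, Units.val_pow_eq_pow_val,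
        Int.cast_pow, map_pow]
      ring
    rw [h, coeff_monomial, coeff_monomial]
    split_ifs with hud
    · rw [hud]
    · simp
  | add p q hp hq => simp [hp, hq, mul_add]

lemma intUnits_cast_ne_zero {K : Type*} [Field K] (u : ℤˣ) : ((u : ℤ) : K) ≠ 0 := by
  rcases Int.units_eq_one_or u with rfl | rfl <;> simp

lemma intUnits_cast_injective {K : Type*} [Field K] (h2 : (2 : K) ≠ 0) {u v : ℤˣ}
    (h : ((u : ℤ) : K) = ((v : ℤ) : K)) : u = v := by
  have hne : (1 : K) ≠ -1 := fun h ↦ h2 (by linear_combination h)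
  rcases Int.units_eq_one_or u with rfl | rfl <;> rcases Int.units_eq_one_or v with rfl | rfl <;>
    simp_all [eq_comm]

lemma degree_signTwist {σ K : Type*} [Field K] (m : MonomialOrder σ) (ε : σ → ℤˣ)
    (p : MvPolynomial σ K) : m.degree (signTwist K ε p) = m.degree p := by
  have : (signTwist K ε p).support = p.support := by
    ext d
    simp [coeff_signTwist, intUnits_cast_ne_zero]
  exact m.toSyn.injective (le_antisymm (m.degree_le_degree_of_support_subset this.le)
    (m.degree_le_degree_of_support_subset this.ge))

/-- Comparing leading coefficients: the sign of an eigenfraction is determined by the parity of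
its degree. -/
lemma prod_sign_degree_of_signTwist {σ K : Type*} [Field K] (h2 : (2 : K) ≠ 0)
    (m : MonomialOrder σ) (ε : σ → ℤˣ) {p q : MvPolynomial σ K} (hp : p ≠ 0) (hq : q ≠ 0) (u : ℤˣ)
    (h : signTwist K ε p * q = C (((u : ℤˣ) : ℤ) : K) * (p * signTwist K ε q)) :
    ((m.degree p).prod fun s k ↦ ε s ^ k) = u * (m.degree q).prod fun s k ↦ ε s ^ k := by
  have hlc : ∀ p : MvPolynomial σ K, m.leadingCoeff (signTwist K ε p) =
      ((((m.degree p).prod fun s k ↦ ε s ^ k : ℤˣ) : ℤ) : K) * m.leadingCoeff p := fun p ↦ by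
    rw [MonomialOrder.leadingCoeff, degree_signTwist, coeff_signTwist]; rfl
  have := congrArg m.leadingCoeff h
  simp only [m.leadingCoeff_mul, m.leadingCoeff_C, hlc] at this
  apply intUnits_cast_injective h2
  have hp' := m.leadingCoeff_ne_zero_iff.mpr hp
  have hq' := m.leadingCoeff_ne_zero_iff.mpr hq
  apply mul_right_cancel₀ (mul_ne_zero hp' hq')
  push_cast
  linear_combination this

lemma eq_zero_of_forall_even {ι : Type*} (S : Set (ι → ℤ)) (heven : ∀ n ∈ S, ∀ i, Even (n i))
    (hdiv : ∀ n : ι → ℤ, (fun i ↦ 2 * n i) ∈ S → n ∈ S) {n : ι → ℤ} (hn : n ∈ S) : n = 0 := by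
  have hpow : ∀ k : ℕ, ∀ n ∈ S, ∀ i, (2 : ℤ) ^ k ∣ n i := by
    intro k
    induction k with
    | zero => simp
    | succ k ih =>
      intro n hn i
      choose t ht using fun i ↦ (heven n hn i).two_dvd
      rw [ht i, pow_succ']
      exact mul_dvd_mul_left _ (ih t (hdiv t (by rwa [← funext ht])) i)
  funext i
  refine Int.eq_zero_of_dvd_of_natAbs_lt_natAbs (hpow (n i).natAbs n hn i) ?_
  simpa [Int.natAbs_pow] using Nat.lt_two_pow_self

/-- Fractions with independent eigencharacters for commuting sign changes of the variables are
algebraically independent. -/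
lemma algebraicIndependent_of_signTwist {σ K ι : Type*} [Field K] (h2 : (2 : K) ≠ 0)
    [Fintype σ] [Fintype ι] [DecidableEq ι] (m : MonomialOrder σ) (ε : ι → σ → ℤˣ)
    (δ : ι → FnField K σ →+* FnField K σ)
    (hδ : ∀ i p, δ i (algebraMap (MvPolynomial σ K) _ p) = algebraMap _ _ (signTwist K (ε i) p))
    (f : ι → FnField K σ) (hf : ∀ j, f j ≠ 0)
    (hδf : ∀ i j, δ i (f j) = if i = j then -f j else f j) :
    AlgebraicIndependent K f := by
  obtain ⟨q, hq⟩ := IsLocalization.exist_integer_multiples_of_finite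
    (nonZeroDivisors (MvPolynomial σ K)) f
  choose p hp using hq
  have hq0 : (q : MvPolynomial σ K) ≠ 0 := nonZeroDivisors.ne_zero q.2
  have hq' : algebraMap (MvPolynomial σ K) (FnField K σ) q ≠ 0 := by simp [hq0]
  simp only [Algebra.smul_def] at hp
  have hfp : f = fun i ↦ algebraMap (MvPolynomial σ K) (FnField K σ) (p i) /
      algebraMap _ _ (q : MvPolynomial σ K) := by
    ext i; rw [hp]; field_simp
  have hp0 : ∀ i, p i ≠ 0 := fun i h ↦ by
    have := hp i
    rw [h, map_zero] at this
    exact mul_ne_zero hq' (hf i) this.symm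
  have hsign : ∀ i j, ((m.degree (p j)).prod fun s k ↦ ε i s ^ k) =
      (if i = j then -1 else 1) * (m.degree (q : MvPolynomial σ K)).prod fun s k ↦ ε i s ^ k := by
    intro i j
    refine prod_sign_degree_of_signTwist h2 m (ε i) (hp0 j) hq0 _ ?_
    apply IsFractionRing.injective (MvPolynomial σ K) (FnField K σ)
    have h1 := congrArg (δ i) (hp j)
    rw [map_mul, hδ, hδ, hδf] at h1
    simp only [map_mul, h1, hp]
    split_ifs
    · simp; ring
    · simp; ring
  rw [hfp]
  refine algebraicIndependent_of_degree m p q hp0 hq0 ?_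
  intro n hn
  refine eq_zero_of_forall_even {n : ι → ℤ | ∀ s, ∑ j, n j *
    ((m.degree (p j) s : ℤ) - m.degree (q : MvPolynomial σ K) s) = 0} ?_ ?_ hn
  · intro n hn i
    have hj : ∀ j, ∏ s, ε i s ^ ((m.degree (p j) s : ℤ) - m.degree (q : MvPolynomial σ K) s) =
        if i = j then -1 else 1 := by
      intro j
      have := hsign i j
      rw [Finsupp.prod_fintype _ _ (by simp), Finsupp.prod_fintype _ _ (by simp)] at this
      simp only [zpow_sub, zpow_natCast, Finset.prod_mul_distrib, Finset.prod_inv_distrib]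
      rw [this, mul_inv_cancel_right]
    have h1 : ∏ j, (∏ s, ε i s ^ ((m.degree (p j) s : ℤ) -
        m.degree (q : MvPolynomial σ K) s)) ^ n j = 1 := by
      simp_rw [← Finset.prod_zpow, ← zpow_mul]
      rw [Finset.prod_comm]
      refine Finset.prod_eq_one fun s _ ↦ ?_
      rw [prod_zpow_eq_zpow_sum]
      simp_rw [mul_comm _ (n _)]
      rw [hn s, zpow_zero]
    simp_rw [hj] at h1
    rw [Finset.prod_eq_single i (by intro j _ hji; simp [hji.symm]) (by simp), if_pos rfl] at h1
    by_contra hodd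
    rw [Int.not_even_iff_odd] at hodd
    rw [hodd.neg_one_zpow] at h1
    exact absurd h1 (by decide)
  · intro n hn s
    have := hn s
    simp only [mul_assoc, ← Finset.mul_sum] at this
    simpa using this

lemma span_sign_eigenvectors {K V ι : Type*} [Field K] (h2 : (2 : K) ≠ 0) [AddCommGroup V]
    [Module K V] (T : ι → V →ₗ[K] V) (hcomm : ∀ i j v, T i (T j v) = T j (T i v))
    (hsq : ∀ i v, T i (T i v) = v) (s : Finset ι) :
    Submodule.span K {v | ∀ i ∈ s, ∃ u : ℤˣ, T i v = ((u : ℤ) : K) • v} = ⊤ := by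
  classical
  induction s using Finset.induction_on with
  | empty => simp
  | insert a s ha ih =>
    rw [eq_top_iff, ← ih, Submodule.span_le]
    intro v hv
    have hv' : v = (2 : K)⁻¹ • ((v + T a v) + (v - T a v)) := by
      rw [show v + T a v + (v - T a v) = (2 : K) • v by rw [two_smul]; abel, smul_smul,
        inv_mul_cancel₀ h2, one_smul]
    rw [hv']
    refine Submodule.smul_mem _ _ (Submodule.add_mem _ (Submodule.subset_span ?_)
      (Submodule.subset_span ?_))
    · intro i hi
      rcases Finset.mem_insert.mp hi with rfl | hi
      · exact ⟨1, by simp [hsq, add_comm]⟩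
      · obtain ⟨u, hu⟩ := hv i hi
        exact ⟨u, by rw [map_add, hcomm i a, hu, map_smul, smul_add]⟩
    · intro i hi
      rcases Finset.mem_insert.mp hi with rfl | hi
      · exact ⟨-1, by simp [hsq]⟩
      · obtain ⟨u, hu⟩ := hv i hi
        exact ⟨u, by rw [map_sub, hcomm i a, hu, map_smul, smul_sub]⟩

/-- Commuting involutions of a finite-dimensional space are simultaneously diagonalizable in
characteristic different from `2`. -/
lemma exists_basis_sign_eigenvectors {K V ι : Type*} [Field K] (h2 : (2 : K) ≠ 0)
    [AddCommGroup V] [Module K V] [Module.Finite K V] [Fintype ι] (T : ι → V →ₗ[K] V)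
    (hcomm : ∀ i j v, T i (T j v) = T j (T i v)) (hsq : ∀ i v, T i (T i v) = v) :
    ∃ (n : ℕ) (b : Module.Basis (Fin n) K V) (ε : ι → Fin n → ℤˣ),
      ∀ i s, T i (b s) = ((ε i s : ℤ) : K) • b s := by
  have hspan := span_sign_eigenvectors h2 T hcomm hsq Finset.univ
  let b := Module.Basis.ofSpan hspan.ge
  have := Module.Finite.finite_basis b
  obtain ⟨n, ⟨e⟩⟩ := Finite.exists_equiv_fin
    ↑((linearIndepOn_empty K id).extend (Set.empty_subset
      {v | ∀ i ∈ Finset.univ, ∃ u : ℤˣ, T i v = ((u : ℤ) : K) • v}))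
  have hb : ∀ i s, ∃ u : ℤˣ, T i (b.reindex e s) = ((u : ℤ) : K) • b.reindex e s := fun i s ↦ by
    rw [b.reindex_apply]
    exact Module.Basis.ofSpan_subset hspan.ge ⟨e.symm s, rfl⟩ i (Finset.mem_univ i)
  choose ε hε using hb
  exact ⟨n, b.reindex e, ε, hε⟩

lemma permGalAction_algebraMap {K σ : Type*} [Field K] (e : Equiv.Perm σ) (p : MvPolynomial σ K) :
    permGalAction K σ e (algebraMap _ _ p) = algebraMap _ _ (rename e p) := by
  simp [permGalAction, permHom]

/-- Rational functions with independent eigencharacters for commuting involutions permuting the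
variables are algebraically independent. -/
lemma algebraicIndependent_of_perm {K σ ι : Type*} [Field K] (h2 : (2 : K) ≠ 0) [Finite σ]
    [Fintype ι] [DecidableEq ι] (e : ι → Equiv.Perm σ) (hcomm : ∀ i j, e i * e j = e j * e i)
    (hsq : ∀ i, e i * e i = 1) (f : ι → FnField K σ) (hf : ∀ j, f j ≠ 0)
    (hef : ∀ i j, permGalAction K σ (e i) (f j) = if i = j then -f j else f j) :
    AlgebraicIndependent K f := by
  obtain ⟨n, b, ε, hε⟩ := exists_basis_sign_eigenvectors h2
    (fun i ↦ Finsupp.lmapDomain K K (e i))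
    (fun i j v ↦ by
      simp only [Finsupp.lmapDomain_apply, ← Finsupp.mapDomain_comp, ← Equiv.Perm.coe_mul, hcomm])
    (fun i v ↦ by
      simp only [Finsupp.lmapDomain_apply, ← Finsupp.mapDomain_comp, ← Equiv.Perm.coe_mul, hsq]
      simp)
  let Θ : MvPolynomial σ K ≃ₐ[K] MvPolynomial (Fin n) K :=
    (SymmetricAlgebra.equivMvPolynomial (Finsupp.basisSingleOne (R := K) (ι := σ))).symm.trans
      (SymmetricAlgebra.equivMvPolynomial b)
  let lin : (σ →₀ K) →ₗ[K] MvPolynomial (Fin n) K :=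
    (SymmetricAlgebra.equivMvPolynomial b).toLinearMap ∘ₗ SymmetricAlgebra.ι K (σ →₀ K)
  have hlinb : ∀ s, lin (b s) = X s := fun s ↦ SymmetricAlgebra.equivMvPolynomial_ι_apply b s
  have hΘX : ∀ g, Θ (X g) = lin (Finsupp.single g 1) := fun g ↦ by
    simp only [Θ, AlgEquiv.trans_apply, SymmetricAlgebra.equivMvPolynomial_symm_X,
      Finsupp.coe_basisSingleOne]
    rfl
  have hlin : ∀ i v, signTwist K (ε i) (lin v) = lin (Finsupp.lmapDomain K K (e i) v) := by
    intro i v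
    have : (signTwist K (ε i)).toLinearMap ∘ₗ lin = lin ∘ₗ Finsupp.lmapDomain K K (e i) :=
      b.ext fun s ↦ by simp [hlinb, hε, signTwist, -Finsupp.lmapDomain_apply]
    exact LinearMap.congr_fun this v
  have hΘ : ∀ i p, signTwist K (ε i) (Θ p) = Θ (rename (e i) p) := by
    intro i p
    have : (signTwist K (ε i)).comp (Θ : MvPolynomial σ K →ₐ[K] MvPolynomial (Fin n) K) =
        (Θ : MvPolynomial σ K →ₐ[K] MvPolynomial (Fin n) K).comp (rename (e i)) := by
      ext1 g
      show signTwist K (ε i) (Θ (X g)) = Θ (rename (e i) (X g))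
      rw [hΘX, hlin, rename_X, hΘX]
      simp
    exact DFunLike.congr_fun this p
  let ΘL : FnField K σ ≃ₐ[K] FnField K (Fin n) :=
    IsFractionRing.fieldEquivOfAlgEquiv K (FnField K σ) (FnField K (Fin n)) Θ
  have hΘL : ∀ p, ΘL (algebraMap _ _ p) = algebraMap _ _ (Θ p) := fun p ↦
    IsFractionRing.fieldEquivOfAlgEquiv_algebraMap K _ _ Θ p
  have key := algebraicIndependent_of_signTwist h2 MonomialOrder.lex ε
    (fun i ↦ ((ΘL.symm.trans (permGalAction K σ (e i))).trans ΘL :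
      FnField K (Fin n) →+* FnField K (Fin n)))
    (fun i p ↦ by
      obtain ⟨p, rfl⟩ := Θ.surjective p
      simp [← hΘL, permGalAction_algebraMap, hΘ])
    (fun j ↦ ΘL (f j)) (fun j ↦ by simpa using hf j)
    (fun i j ↦ by
      simp only [RingHom.coe_coe, AlgEquiv.trans_apply, AlgEquiv.symm_apply_apply, hef]
      split_ifs <;> simp)
  exact (AlgHom.algebraicIndependent_iff (ΘL : FnField K σ →ₐ[K] FnField K (Fin n))
    ΘL.injective).mp key

lemma trdeg_eq (K L : Type*) [CommRing K] [CommRing L] [Algebra K L] :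
    trdeg K L = Algebra.trdeg K L := rfl

lemma galAction_apply {K G : Type*} [Field K] [Group G] (g : G) (x : FnField K G) :
    galAction K G g x = permGalAction K G (MulAction.toPermHom G G g) x := rfl

/-- If an elementary abelian `2`-group acts faithfully on `E`, then `E` contains eigenvectors for
the coordinate characters. -/
lemma exists_sign_eigenvectors {K L : Type*} [Field K] [Field L] [Algebra K L] {r : ℕ}
    (γ : (Fin r → ℤˣ) →* (L ≃ₐ[K] L)) (E : IntermediateField K L)
    (hst : ∀ a, ∀ x ∈ E, γ a x ∈ E) (hf : ∀ a, a ≠ 1 → ∃ x ∈ E, γ a x ≠ x) :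
    ∃ f : Fin r → L, (∀ j, f j ∈ E) ∧ (∀ j, f j ≠ 0) ∧
      ∀ a j, γ a (f j) = (((a j : ℤˣ) : ℤ) : L) * f j := by
  let φ (a : Fin r → ℤˣ) : E →* L := ((γ a : L →* L)).comp (algebraMap E L)
  have hφ : Function.Injective φ := by
    intro a b hab
    by_contra hne
    obtain ⟨x, hx, hxne⟩ := hf (b⁻¹ * a) fun h ↦ hne (inv_mul_eq_one.mp h).symm
    apply hxne
    have h1 : γ a x = γ b x := DFunLike.congr_fun hab ⟨x, hx⟩
    rw [map_mul, AlgEquiv.mul_apply, h1, ← AlgEquiv.mul_apply, ← map_mul]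
    simp
  have hli := (linearIndependent_monoidHom E L).comp φ hφ
  rw [Fintype.linearIndependent_iff] at hli
  have hex : ∀ j, ∃ h ∈ E, ∑ a, (((a j : ℤˣ) : ℤ) : L) * γ a h ≠ 0 := by
    intro j
    by_contra! hcon
    have := hli (fun a ↦ (((a j : ℤˣ) : ℤ) : L)) (by
      ext x
      simpa [φ] using hcon x x.2) 1
    simp at this
  choose h hh hne using hex
  refine ⟨fun j ↦ ∑ a, (((a j : ℤˣ) : ℤ) : L) * γ a (h j), fun j ↦
    sum_mem fun a _ ↦ mul_mem (intCast_mem _ _) (hst _ _ (hh j)), hne, fun b j ↦ ?_⟩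
  simp only [map_sum, map_mul, map_intCast, ← AlgEquiv.mul_apply, Finset.mul_sum]
  refine Fintype.sum_equiv (Equiv.mulLeft b) _ _ fun a ↦ ?_
  have : (b j : ℤ) * ((b * a) j : ℤˣ) = ((a j : ℤˣ) : ℤ) := by
    rw [← Units.val_mul, Pi.mul_apply, ← mul_assoc, Int.units_mul_self, one_mul]
  rw [← mul_assoc, Equiv.coe_mulLeft, ← Int.cast_mul, this, map_mul]

/-- A finite group containing an elementary abelian `2`-group of rank `r` has essential
dimension at least `r` in characteristic different from `2`. -/
lemma le_trdeg_of_elementary_two {K G : Type*} [Field K] [Group G] [Finite G] (h2 : (2 : K) ≠ 0)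
    {r : ℕ} (ρ : (Fin r → ℤˣ) →* G) (hρ : Function.Injective ρ)
    (E : IntermediateField K (FnField K G)) (hst : ∀ g : G, ∀ x ∈ E, galAction K G g x ∈ E)
    (hf : ∀ g : G, g ≠ 1 → ∃ x ∈ E, galAction K G g x ≠ x) :
    (r : Cardinal) ≤ trdeg K E := by
  obtain ⟨f, hfE, hne, hact⟩ := exists_sign_eigenvectors ((galAction K G).comp ρ) E
    (fun a ↦ hst (ρ a)) (fun a ha ↦ hf (ρ a) fun h ↦ ha (hρ (h.trans (map_one ρ).symm)))
  have hind : AlgebraicIndependent K f := by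
    refine algebraicIndependent_of_perm h2
      (fun i ↦ MulAction.toPermHom G G (ρ (Pi.mulSingle i (-1)))) (fun i j ↦ ?_) (fun i ↦ ?_)
      f hne fun i j ↦ ?_
    · rw [← map_mul, ← map_mul, ← map_mul, ← map_mul, mul_comm]
    · rw [← map_mul, ← map_mul, ← Pi.mulSingle_mul, neg_mul_neg, one_mul, Pi.mulSingle_one,
        map_one, map_one]
    · refine (hact (Pi.mulSingle i (-1)) j).trans ?_
      generalize f j = x
      by_cases hij : i = j
      · subst hij; simp
      · rw [Pi.mulSingle_eq_of_ne (Ne.symm hij)]; simp [hij]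
  have hindE : AlgebraicIndependent K (fun j ↦ (⟨f j, hfE j⟩ : E)) :=
    AlgebraicIndependent.of_comp E.val hind
  simpa [trdeg_eq] using hindE.lift_cardinalMk_le_trdeg

lemma exists_elementary_two_hom {r n : ℕ} (h : 2 * r ≤ n) :
    ∃ ρ : (Fin r → ℤˣ) →* Equiv.Perm (Fin n), Function.Injective ρ := by
  have hcard : Fintype.card (Σ _ : Fin r, ℤˣ) ≤ Fintype.card (Fin n) := by simp; omega
  obtain ⟨ι⟩ := Function.Embedding.nonempty_of_card_le hcard
  refine ⟨((Equiv.Perm.viaEmbeddingHom ι).comp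
    (Equiv.Perm.sigmaCongrRightHom fun _ : Fin r ↦ ℤˣ)).comp
      (MonoidHom.pi fun i ↦ (MulAction.toPermHom ℤˣ ℤˣ).comp (Pi.evalMonoidHom _ i)), ?_⟩
  simp only [MonoidHom.coe_comp]
  refine ((Equiv.Perm.viaEmbeddingHom_injective ι).comp
    Equiv.Perm.sigmaCongrRightHom_injective).comp fun a b hab ↦ funext fun i ↦ ?_
  have : a i • (1 : ℤˣ) = b i • (1 : ℤˣ) := DFunLike.congr_fun (congrFun hab i) 1
  simpa using this

lemma mem_range_algebraMap_of_isAlgebraic {K σ : Type*} [Field K] {x : FnField K σ}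
    (hx : IsAlgebraic K x) : x ∈ Set.range (algebraMap K (FnField K σ)) := by
  have hint : ∀ y : FnField K σ, IsAlgebraic K y → ∃ p : MvPolynomial σ K, algebraMap _ _ p = y :=
    fun y hy ↦ IsIntegrallyClosed.isIntegral_iff.mp (hy.isIntegral.tower_top)
  obtain ⟨p, hp⟩ := hint x hx
  obtain ⟨q, hq⟩ := hint x⁻¹ hx.inv
  rcases eq_or_ne x 0 with rfl | h0
  · exact ⟨0, map_zero _⟩
  have hpq : p * q = 1 := by
    apply IsFractionRing.injective (MvPolynomial σ K) (FnField K σ)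
    rw [map_mul, hp, hq, mul_inv_cancel₀ h0, map_one]
  obtain ⟨c, -, rfl⟩ := isUnit_iff_eq_C_of_isReduced.mp (IsUnit.of_mul_eq_one q hpq)
  exact ⟨c, hp⟩

lemma exists_transcendental_of_faithful {K G : Type*} [Field K] [Group G] [Nontrivial G]
    (E : IntermediateField K (FnField K G))
    (hf : ∀ g : G, g ≠ 1 → ∃ x ∈ E, galAction K G g x ≠ x) : ∃ x ∈ E, Transcendental K x := by
  obtain ⟨g, hg⟩ := exists_ne (1 : G)
  obtain ⟨x, hx, hne⟩ := hf g hg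
  refine ⟨x, hx, fun halg ↦ ?_⟩
  obtain ⟨c, rfl⟩ := mem_range_algebraMap_of_isAlgebraic halg
  exact hne (AlgEquiv.commutes _ c)

lemma one_le_trdeg {K G : Type*} [Field K] [Group G] [Nontrivial G]
    (E : IntermediateField K (FnField K G))
    (hf : ∀ g : G, g ≠ 1 → ∃ x ∈ E, galAction K G g x ≠ x) : 1 ≤ trdeg K E := by
  obtain ⟨x, hx, ht⟩ := exists_transcendental_of_faithful E hf
  have : Algebra.Transcendental K E :=
    ⟨⟨x, hx⟩, fun h ↦ ht (h.algHom E.val)⟩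
  rw [trdeg_eq, Cardinal.one_le_iff_pos]
  exact trdeg_pos K E

/-- In characteristic `2`, a Möbius transformation of order dividing `4` is an involution. -/
lemma apply_apply_of_moebius {k L : Type*} [Field k] [Field L] [Algebra k L] (h2 : (2 : k) = 0)
    {x : L} (hx : Transcendental k x) (τ : L ≃ₐ[k] L) (hτ : τ (τ (τ (τ x))) = x) {a b c d : k}
    (h0 : algebraMap k L c * x + algebraMap k L d ≠ 0)
    (h : τ x * (algebraMap k L c * x + algebraMap k L d) =
      algebraMap k L a * x + algebraMap k L b) : τ (τ x) = x := by
  have step : ∀ (σ : L ≃ₐ[k] L) (a b c d : k), algebraMap k L c * x + algebraMap k L d ≠ 0 →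
      σ x * (algebraMap k L c * x + algebraMap k L d) = algebraMap k L a * x + algebraMap k L b →
      algebraMap k L (c * a + d * c) * x + algebraMap k L (c * b + d * d) ≠ 0 ∧
      σ (σ x) * (algebraMap k L (c * a + d * c) * x + algebraMap k L (c * b + d * d)) =
        algebraMap k L (a * a + b * c) * x + algebraMap k L (a * b + b * d) := by
    intro σ a b c d h0 h
    have h1 := congrArg σ h
    have h0' : σ (algebraMap k L c * x + algebraMap k L d) ≠ 0 := (map_ne_zero σ).mpr h0
    simp only [map_mul, map_add, AlgEquiv.commutes] at h1 h0' ⊢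
    have e : (algebraMap k L c * algebraMap k L a + algebraMap k L d * algebraMap k L c) * x +
        (algebraMap k L c * algebraMap k L b + algebraMap k L d * algebraMap k L d) =
        (algebraMap k L c * σ x + algebraMap k L d) *
          (algebraMap k L c * x + algebraMap k L d) := by
      linear_combination (-algebraMap k L c) * h
    rw [e]
    refine ⟨mul_ne_zero h0' h0, ?_⟩
    rw [← mul_assoc, h1]
    linear_combination algebraMap k L a * h
  obtain ⟨g0, g⟩ := step τ a b c d h0 h
  obtain ⟨-, g4⟩ := step (τ * τ) _ _ _ _ g0 g
  simp only [AlgEquiv.mul_apply, hτ] at g4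
  have hz : ∀ p q r s : k, x * (algebraMap k L p * x + algebraMap k L q) =
      algebraMap k L r * x + algebraMap k L s → q = r := by
    intro p q r s hpq
    by_contra hq
    refine hx ⟨Polynomial.C p * Polynomial.X ^ 2 + Polynomial.C (q - r) * Polynomial.X -
      Polynomial.C s, fun h ↦ hq (sub_eq_zero.mp ?_), ?_⟩
    · have := congrArg (Polynomial.coeff · 1) h
      simpa [Polynomial.coeff_X, Polynomial.coeff_C, Polynomial.coeff_X_pow] using this
    · simp only [map_sub, map_add, map_mul, map_pow, Polynomial.aeval_C, Polynomial.aeval_X]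
      linear_combination hpq
  have had : a = d := by
    have hq := hz _ _ _ _ g4
    have : (a - d) ^ 4 = 0 := by
      linear_combination (-1) * hq + h2 * (3 * a ^ 2 * d ^ 2 - 2 * a ^ 3 * d - 2 * a * d ^ 3 +
        d ^ 4 + b * c * (d ^ 2 - a ^ 2))
    exact sub_eq_zero.mp (pow_eq_zero_iff (by norm_num) |>.mp this)
  subst had
  rw [show c * a + a * c = 0 by linear_combination (c * a) * h2,
    show a * b + b * a = 0 by linear_combination (a * b) * h2,
    show a * a + b * c = c * b + a * a by ring] at g
  rw [show c * a + a * c = 0 by linear_combination (c * a) * h2] at g0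
  simp only [map_zero, zero_mul, zero_add, add_zero] at g g0
  rw [mul_comm] at g
  exact mul_left_cancel₀ g0 g

/-- In characteristic `2`, an automorphism of order dividing `4` of a rational function field in
one variable is an involution. -/
lemma RatFunc.apply_apply_of_pow_four {k : Type*} [Field k] (h2 : (2 : k) = 0)
    (τ : RatFunc k ≃ₐ[k] RatFunc k) (hτ : ∀ x, τ (τ (τ (τ x))) = x) (x : RatFunc k) :
    τ (τ x) = x := by
  have htop : IntermediateField.adjoin k {τ RatFunc.X} = ⊤ := by
    have := congrArg (IntermediateField.map (τ : RatFunc k →ₐ[k] RatFunc k))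
      (RatFunc.adjoin_X (K := k))
    rw [IntermediateField.adjoin_map, Set.image_singleton] at this
    rw [show τ RatFunc.X = (τ : RatFunc k →ₐ[k] RatFunc k) RatFunc.X from rfl, this]
    exact eq_top_iff.mpr fun y _ ↦ ⟨τ.symm y, trivial, τ.apply_symm_apply y⟩
  have hdeg := (τ RatFunc.X).finrank_eq_max_natDegree
  rw [htop, IntermediateField.finrank_top] at hdeg
  obtain ⟨a, b, hab⟩ := Polynomial.exists_eq_X_add_C_of_natDegree_le_one
    ((le_max_left _ _).trans hdeg.ge)
  obtain ⟨c, d, hcd⟩ := Polynomial.exists_eq_X_add_C_of_natDegree_le_one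
    ((le_max_right _ _).trans hdeg.ge)
  have hX : τ (τ RatFunc.X) = (RatFunc.X : RatFunc k) := by
    have hden : algebraMap k (RatFunc k) c * RatFunc.X + algebraMap k (RatFunc k) d =
        algebraMap _ _ (τ RatFunc.X).denom := by
      rw [hcd]; simp [RatFunc.algebraMap_eq_C]
    have hnum : algebraMap k (RatFunc k) a * RatFunc.X + algebraMap k (RatFunc k) b =
        algebraMap _ _ (τ RatFunc.X).num := by
      rw [hab]; simp [RatFunc.algebraMap_eq_C]
    have hne : algebraMap (Polynomial k) (RatFunc k) (τ RatFunc.X).denom ≠ 0 := by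
      simpa using (τ RatFunc.X).denom_ne_zero
    refine apply_apply_of_moebius (a := a) (b := b) h2 RatFunc.transcendental_X τ (hτ _)
      (hden ▸ hne) ?_
    rw [hden, hnum, ← eq_div_iff hne, RatFunc.num_div_denom]
  have hpoly : ∀ p : Polynomial k, τ (τ (algebraMap _ (RatFunc k) p)) = algebraMap _ _ p := by
    intro p
    have : ((τ : RatFunc k →ₐ[k] RatFunc k).comp (τ : RatFunc k →ₐ[k] RatFunc k)).comp
        (IsScalarTower.toAlgHom k (Polynomial k) (RatFunc k)) = IsScalarTower.toAlgHom k _ _ :=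
      Polynomial.algHom_ext (by simpa using hX)
    exact DFunLike.congr_fun this p
  rw [← RatFunc.num_div_denom x, map_div₀, map_div₀, hpoly, hpoly]

/-- In characteristic `2`, an automorphism of order dividing `4` of a subfield of a rational
function field in one variable is an involution. -/
lemma apply_apply_of_pow_four_of_ratFunc {k F : Type*} [Field k] [Field F] [Algebra k F]
    (h2 : (2 : k) = 0) (φ : F →ₐ[k] RatFunc k)
    (τ : F ≃ₐ[k] F) (hτ : ∀ x, τ (τ (τ (τ x))) = x) (x : F) : τ (τ x) = x := by
  by_cases hbot : φ.fieldRange = ⊥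
  · obtain ⟨c, hc⟩ := IntermediateField.mem_bot.mp
      (show φ x ∈ ⊥ from hbot ▸ AlgHom.mem_fieldRange.mpr ⟨x, rfl⟩)
    rw [← φ.commutes] at hc
    rw [← φ.injective hc, τ.commutes, τ.commutes]
  · let e : F ≃ₐ[k] RatFunc k := (AlgEquiv.ofInjectiveField φ).trans
      (RatFunc.Luroth.algEquiv hbot).symm
    have := RatFunc.apply_apply_of_pow_four h2 ((e.symm.trans τ).trans e)
      (fun y ↦ by simp [hτ]) (e x)
    simpa using this

/-- In a transcendence basis, some element can be exchanged for a given transcendental element. -/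
lemma IsTranscendenceBasis.exists_exchange {K L σ : Type*} [Field K] [Field L] [Algebra K L]
    {x : σ → L} (hx : IsTranscendenceBasis K x) {e : L} (he : Transcendental K e) :
    ∃ i : σ, AlgebraicIndependent K
      (Sum.elim (fun j : {j // j ≠ i} ↦ x j) (fun _ : Unit ↦ e)) := by
  have hB₂ : (AlgebraicIndependent.matroid K L).IsBase (Set.range x) :=
    AlgebraicIndependent.matroid_isBase_iff.mpr hx.to_subtype_range
  have hinj : Function.Injective x := hx.1.injective
  suffices ∃ i : σ, (∀ j, j ≠ i → x j ≠ e) ∧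
      (AlgebraicIndependent.matroid K L).Indep (insert e (Set.range x \ {x i})) by
    obtain ⟨i, hne, hB⟩ := this
    refine ⟨i, ?_⟩
    have hB' : AlgebraicIndependent K
        ((↑) : (insert e (Set.range x \ {x i}) : Set L) → L) := hB
    let f : {j // j ≠ i} ⊕ Unit → (insert e (Set.range x \ {x i}) : Set L) :=
      Sum.elim (fun j ↦ ⟨x j, .inr ⟨⟨j, rfl⟩, fun h ↦ j.2 (hinj h)⟩⟩) (fun _ ↦ ⟨e, .inl rfl⟩)
    have hf : Function.Injective f := by
      rintro (j | j) (j' | j') h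
      · simpa [f, hinj.eq_iff, Subtype.ext_iff] using h
      · exact absurd (congrArg Subtype.val h) (hne j j.2)
      · exact absurd (congrArg Subtype.val h).symm (hne j' j'.2)
      · rfl
    convert hB'.comp f hf using 1
    ext (j | j) <;> rfl
  by_cases hex : e ∈ Set.range x
  · obtain ⟨i, rfl⟩ := hex
    refine ⟨i, fun j hj h ↦ hj (hinj h), ?_⟩
    rw [Set.insert_sdiff_singleton, Set.insert_eq_of_mem (Set.mem_range_self i)]
    exact hB₂.indep
  · have hI : (AlgebraicIndependent.matroid K L).Indep {e} :=
      AlgebraicIndependent.matroid_indep_iff.mpr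
        ((algebraicIndependent_singleton_iff (⟨e, rfl⟩ : ({e} : Set L))).mpr he)
    obtain ⟨B₁, hB₁, heB₁, hsub⟩ := hI.exists_isBase_subset_union_isBase hB₂
    have heB₁ : e ∈ B₁ := heB₁ rfl
    have hdiff : B₁ \ Set.range x = {e} := by
      ext y
      refine ⟨fun hy ↦ (hsub hy.1).resolve_right hy.2, ?_⟩
      rintro rfl
      exact ⟨heB₁, hex⟩
    have hcard := hB₁.encard_sdiff_comm hB₂
    rw [hdiff, Set.encard_singleton, eq_comm, Set.encard_eq_one] at hcard
    obtain ⟨f, hf⟩ := hcard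
    obtain ⟨i, rfl⟩ := (hf.ge rfl).1
    refine ⟨i, fun j _ h ↦ hex ⟨j, h⟩, hB₁.indep.subset (Set.insert_subset heB₁ fun y hy ↦ ?_)⟩
    by_contra hyB
    exact hy.2 (hf.le ⟨hy.1, hyB⟩)

/-- All but one of the variables are algebraically independent over a subfield of transcendence
degree one. -/
lemma IsTranscendenceBasis.exists_algebraicIndependent_intermediateField {K L σ : Type*} [Field K]
    [Field L] [Algebra K L] {x : σ → L} (hx : IsTranscendenceBasis K x)
    (E : IntermediateField K L) (hE : Algebra.trdeg K E ≤ 1) {e : L} (heE : e ∈ E)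
    (he : Transcendental K e) :
    ∃ i : σ, AlgebraicIndependent E (fun j : {j // j ≠ i} ↦ x j) := by
  obtain ⟨i, hi⟩ := hx.exists_exchange he
  refine ⟨i, ?_⟩
  obtain ⟨-, hi⟩ := (AlgebraicIndependent.sumElim_iff (R := K) (A := L)).mp hi
  let e' : Unit → E := fun _ ↦ ⟨e, heE⟩
  have he' : AlgebraicIndependent K e' :=
    algebraicIndependent_unique_type_iff.mpr fun h ↦ he (h.algHom E.val)
  have := (he'.isTranscendenceBasis_of_lift_trdeg_le_of_finite (by simpa using hE)).isAlgebraic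
  have hmem : ∀ a ∈ Algebra.adjoin K (Set.range e'),
      (a : L) ∈ Algebra.adjoin K (Set.range fun _ : Unit ↦ e) := by
    intro a ha
    have := (Subalgebra.mem_map (f := E.val)).mpr ⟨a, ha, rfl⟩
    rwa [AlgHom.map_adjoin, ← Set.range_comp] at this
  let f : Algebra.adjoin K (Set.range e') →+* Algebra.adjoin K (Set.range fun _ : Unit ↦ e) :=
    ((algebraMap E L).comp (algebraMap _ E)).codRestrict
      (Algebra.adjoin K (Set.range fun _ : Unit ↦ e)) fun a ↦ hmem a a.2
  have hA : AlgebraicIndependent (Algebra.adjoin K (Set.range e'))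
      (fun j : {j // j ≠ i} ↦ x j) :=
    AlgebraicIndependent.of_ringHom_of_comp_eq f (RingHom.id L) hi
      (fun a b h ↦ Subtype.ext (Subtype.ext (congrArg Subtype.val h :))) rfl
  exact hA.extendScalars E

/-- Let `L` be the rational function field over `K` in the variables `x` and `y`, and let `M` be a
subfield containing the variables `x`. In characteristic `2`, an automorphism of `M` over `K(x)`
of order dividing `4` is an involution. -/
lemma apply_apply_of_adjoin_eq_top {K M L J : Type*} [Field K] [Field M] [Field L] [Algebra K M]
    [Algebra K L] [Algebra M L] [IsScalarTower K M L] (h2 : (2 : K) = 0) {x : J → M} {y : L}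
    (hy : AlgebraicIndependent K (fun o : Option J ↦ o.elim y (fun j ↦ algebraMap M L (x j))))
    (htop : IntermediateField.adjoin K (insert y (Set.range fun j ↦ algebraMap M L (x j))) = ⊤)
    (τ : M ≃ₐ[K] M) (hx : ∀ j, τ (x j) = x j) (hτ : ∀ m, τ (τ (τ (τ m))) = m) (m : M) :
    τ (τ m) = m := by
  let k := IntermediateField.adjoin K (Set.range x)
  have hmem : ∀ a ∈ Algebra.adjoin K (Set.range x),
      algebraMap M L a ∈ Algebra.adjoin K (Set.range fun j ↦ algebraMap M L (x j)) := by
    intro a ha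
    have := (Subalgebra.mem_map (f := IsScalarTower.toAlgHom K M L)).mpr ⟨a, ha, rfl⟩
    rwa [AlgHom.map_adjoin, ← Set.range_comp] at this
  have hyk : Transcendental k y := by
    rw [IntermediateField.transcendental_adjoin_iff]
    let f : Algebra.adjoin K (Set.range x) →+*
        Algebra.adjoin K (Set.range fun j ↦ algebraMap M L (x j)) :=
      ((algebraMap M L).comp (algebraMap _ M)).codRestrict
        (Algebra.adjoin K (Set.range fun j ↦ algebraMap M L (x j))) fun a ↦ hmem a a.2
    refine Transcendental.of_ringHom_of_comp_eq f (RingHom.id L) ?_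
      (fun a b h ↦ Subtype.ext ((algebraMap M L).injective (congrArg Subtype.val h :))) rfl
    exact ((hy.comp some (Option.some_injective _)).option_iff_transcendental y).mp hy
  have hytop : IntermediateField.adjoin k {y} = ⊤ := by
    apply IntermediateField.restrictScalars_injective K
    rw [IntermediateField.restrictScalars_top, eq_top_iff, ← htop, IntermediateField.adjoin_le_iff]
    rintro _ (rfl | ⟨j, rfl⟩)
    · exact IntermediateField.mem_adjoin_simple_self k _
    · exact (IntermediateField.adjoin k {y}).algebraMap_mem
        ⟨x j, IntermediateField.subset_adjoin K _ ⟨j, rfl⟩⟩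
  have hfix : ∀ a ∈ k, τ a = a := by
    intro a ha
    induction ha using IntermediateField.adjoin_induction with
    | mem a ha => obtain ⟨j, rfl⟩ := ha; exact hx j
    | algebraMap a => exact τ.commutes a
    | add a b _ _ ha hb => rw [map_add, ha, hb]
    | inv a _ ha => rw [map_inv₀, ha]
    | mul a b _ _ ha hb => rw [map_mul, ha, hb]
  let φ : M →ₐ[k] RatFunc k :=
    ((((RatFunc.algEquivOfTranscendental y hyk).trans (IntermediateField.equivOfEq hytop)).trans
      IntermediateField.topEquiv).symm : L →ₐ[k] RatFunc k).comp (IsScalarTower.toAlgHom k M L)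
  exact apply_apply_of_pow_four_of_ratFunc (by rw [← map_ofNat (algebraMap K k), h2, map_zero]) φ
    (AlgEquiv.ofRingEquiv (f := τ.toRingEquiv) fun a ↦ hfix a a.2) hτ m

lemma isTranscendenceBasis_fnField (K σ : Type*) [Field K] :
    IsTranscendenceBasis K
      (fun i : σ ↦ (algebraMap (MvPolynomial σ K) (FnField K σ) (X i))) := by
  have : Algebra.IsAlgebraic (MvPolynomial σ K) (FnField K σ) :=
    IsLocalization.isAlgebraic _ (nonZeroDivisors (MvPolynomial σ K))
  exact (IsTranscendenceBasis.mvPolynomial σ K).algebraMap_comp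

lemma adjoin_fnField_eq_top (K σ : Type*) [Field K] :
    IntermediateField.adjoin K (Set.range
      fun i : σ ↦ (algebraMap (MvPolynomial σ K) (FnField K σ) (X i))) = ⊤ := by
  have hpoly : ∀ p : MvPolynomial σ K, algebraMap _ (FnField K σ) p ∈ IntermediateField.adjoin K
      (Set.range fun i : σ ↦ (algebraMap (MvPolynomial σ K) (FnField K σ) (X i))) := by
    intro p
    induction p using MvPolynomial.induction_on with
    | C a => exact IntermediateField.algebraMap_mem _ a
    | add p q hp hq => rw [map_add]; exact add_mem hp hq
    | mul_X p i hp =>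
      rw [map_mul]; exact mul_mem hp (IntermediateField.subset_adjoin K _ ⟨i, rfl⟩)
  rw [eq_top_iff]
  intro z _
  obtain ⟨p, q, -, rfl⟩ := IsFractionRing.div_surjective (MvPolynomial σ K) z
  exact div_mem (hpoly p) (hpoly q)

/-- Let `L` be the rational function field over `K` in the variables `x` and `y`, and let `E` be a
subfield over which the variables `x` are algebraically independent. In characteristic `2`, an
automorphism of `E` of order dividing `4` is an involution. -/
lemma apply_apply_of_algebraicIndependent {K L J : Type*} [Field K] [Field L]
    [Algebra K L] (h2 : (2 : K) = 0) (E : IntermediateField K L) {x : J → L} {y : L}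
    (hx : AlgebraicIndependent E x)
    (hy : AlgebraicIndependent K (fun o : Option J ↦ o.elim y x))
    (htop : IntermediateField.adjoin K (insert y (Set.range x)) = ⊤)
    (τ : E ≃ₐ[K] E) (hτ : ∀ a, τ (τ (τ (τ a))) = a) (a : E) : τ (τ a) = a := by
  let φ : FractionRing (MvPolynomial J E) →ₐ[K] L :=
    IsFractionRing.liftAlgHom (g := (aeval x : MvPolynomial J E →ₐ[E] L).restrictScalars K) hx
  have hφ : ∀ p, φ (algebraMap _ _ p) = aeval x p :=
    fun p ↦ IsFractionRing.lift_algebraMap hx p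
  let _ : Algebra (FractionRing (MvPolynomial J E)) L := φ.toRingHom.toAlgebra
  have : IsScalarTower K (FractionRing (MvPolynomial J E)) L :=
    IsScalarTower.of_algebraMap_eq' φ.comp_algebraMap.symm
  have hmap : ∀ z, algebraMap (FractionRing (MvPolynomial J E)) L z = φ z := fun _ ↦ rfl
  let τ' : FractionRing (MvPolynomial J E) ≃ₐ[K] FractionRing (MvPolynomial J E) :=
    IsFractionRing.algEquivOfAlgEquiv (mapAlgEquiv J τ)
  have hτp : ∀ p, τ' (algebraMap _ _ p) = algebraMap _ _ (map (τ : E →+* E) p) :=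
    fun p ↦ IsFractionRing.algEquivOfAlgEquiv_algebraMap _ p
  have hτ4 : ∀ m, τ' (τ' (τ' (τ' m))) = m := by
    have h4 : (τ : E →+* E).comp ((τ : E →+* E).comp ((τ : E →+* E).comp (τ : E →+* E))) =
        RingHom.id E := RingHom.ext hτ
    intro m
    obtain ⟨p, q, -, rfl⟩ := IsFractionRing.div_surjective (MvPolynomial J E) m
    simp only [map_div₀, hτp, map_map, h4, map_id]
  have hxx : (fun j ↦ algebraMap (FractionRing (MvPolynomial J E)) L
      (algebraMap (MvPolynomial J E) _ (X j))) = x := by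
    ext j; rw [hmap, hφ, aeval_X]
  have key := apply_apply_of_adjoin_eq_top (J := J) h2
    (x := fun j ↦ algebraMap _ (FractionRing (MvPolynomial J E)) (X j)) (y := y)
    (by rwa [hxx]) (by rwa [hxx]) τ' (fun j ↦ by rw [hτp, map_X]) hτ4
    (algebraMap (MvPolynomial J E) _ (C a))
  rw [hτp, hτp, map_C, map_C] at key
  exact C_injective _ _ (IsFractionRing.injective _ _ key)

lemma AlgebraicIndependent.option_elim {R A σ : Type*} [CommRing R] [CommRing A] [Algebra R A]
    {x : σ → A} (hx : AlgebraicIndependent R x) (i : σ) :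
    AlgebraicIndependent R (fun o : Option {j // j ≠ i} ↦ o.elim (x i) (fun j ↦ x j)) := by
  have := hx.comp (fun o : Option {j // j ≠ i} ↦ o.elim i Subtype.val) (by
    rintro (_ | j) (_ | j') h
    · rfl
    · exact absurd h.symm j'.2
    · exact absurd h j.2
    · exact congrArg some (Subtype.ext h))
  convert this using 1
  ext (_ | j) <;> rfl

/-- In characteristic `2`, a group with an element of order `4` has essential dimension at
least `2`. -/
lemma two_le_trdeg_of_pow_four {K G : Type*} [Field K] [Group G] (h2 : (2 : K) = 0)
    {g : G} (hg4 : g ^ 4 = 1) (hg2 : g ^ 2 ≠ 1) (E : IntermediateField K (FnField K G))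
    (hst : ∀ g : G, ∀ x ∈ E, galAction K G g x ∈ E)
    (hf : ∀ g : G, g ≠ 1 → ∃ x ∈ E, galAction K G g x ≠ x) : 2 ≤ trdeg K E := by
  classical
  by_contra hE
  replace hE : Algebra.trdeg K E ≤ 1 := by
    rw [← Order.lt_succ_iff, ← Nat.cast_one, Cardinal.succ_natCast, Nat.cast_one,
      one_add_one_eq_two]
    exact not_le.mp hE
  have : Nontrivial G := ⟨g ^ 2, 1, hg2⟩
  obtain ⟨e, heE, he⟩ := exists_transcendental_of_faithful E hf
  obtain ⟨i, hi⟩ := (isTranscendenceBasis_fnField K G).exists_algebraicIndependent_intermediateField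
    E hE heE he
  have hinv : ∀ (g : G) (a : FnField K G), galAction K G g (galAction K G g⁻¹ a) = a := by
    intro g a
    rw [← AlgEquiv.mul_apply, ← map_mul, mul_inv_cancel, map_one, AlgEquiv.one_apply]
  have hinv' : ∀ (g : G) (a : FnField K G), galAction K G g⁻¹ (galAction K G g a) = a := by
    intro g a
    rw [← AlgEquiv.mul_apply, ← map_mul, inv_mul_cancel, map_one, AlgEquiv.one_apply]
  let τ : E ≃ₐ[K] E :=
    AlgEquiv.ofAlgHom
      (((galAction K G g : FnField K G →ₐ[K] FnField K G).comp E.val).codRestrict E.toSubalgebra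
        fun a ↦ hst g a a.2)
      (((galAction K G g⁻¹ : FnField K G →ₐ[K] FnField K G).comp E.val).codRestrict E.toSubalgebra
        fun a ↦ hst g⁻¹ a a.2)
      (AlgHom.ext fun a ↦ Subtype.ext (hinv g a))
      (AlgHom.ext fun a ↦ Subtype.ext (hinv' g a))
  have hτ : ∀ a : E, (τ a : FnField K G) = galAction K G g a := fun _ ↦ rfl
  refine (hf _ hg2).elim fun a ⟨ha, hne⟩ ↦ hne ?_
  have key := apply_apply_of_algebraicIndependent h2 E hi
    (y := algebraMap (MvPolynomial G K) (FnField K G) (X i)) ?_ ?_ τ (fun a ↦ Subtype.ext ?_)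
    ⟨a, ha⟩
  · rw [pow_two, map_mul]
    exact congrArg Subtype.val key
  · exact (isTranscendenceBasis_fnField K G).1.option_elim i
  · rw [← adjoin_fnField_eq_top K G]
    congr 1
    ext z
    constructor
    · rintro (rfl | ⟨j, rfl⟩)
      exacts [⟨i, rfl⟩, ⟨j, rfl⟩]
    · rintro ⟨j, rfl⟩
      by_cases hj : j = i
      · exact .inl (by rw [hj])
      · exact .inr ⟨⟨j, hj⟩, rfl⟩
  · rw [hτ, hτ, hτ, hτ]
    simp only [← AlgEquiv.mul_apply, ← map_mul]
    rw [show g * (g * (g * g)) = g ^ 4 by simp only [pow_succ, pow_zero, one_mul, mul_assoc], hg4, map_one, AlgEquiv.one_apply]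

open scoped IntermediateField.algebraAdjoinAdjoin in
lemma IntermediateField.trdeg_le_of_le_adjoin {K L : Type*} [Field K] [Field L] [Algebra K L]
    {m : ℕ} (w : Fin m → L) {E : IntermediateField K L}
    (hE : E ≤ IntermediateField.adjoin K (Set.range w)) : Algebra.trdeg K E ≤ m := by
  refine (trdeg_le_of_injective (IntermediateField.inclusion hE)
    (IntermediateField.inclusion_injective hE)).trans ?_
  rw [← trdeg_add_eq K (S := Algebra.adjoin K (Set.range w)),
    trdeg_eq_zero (R := Algebra.adjoin K (Set.range w)), add_zero]
  have hsurj : Function.Surjective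
      ((aeval w).codRestrict (Algebra.adjoin K (Set.range w)) fun p ↦ by
        simp [Algebra.adjoin_range_eq_range_aeval]) := by
    rintro ⟨a, ha⟩
    obtain ⟨p, rfl⟩ := by rwa [Algebra.adjoin_range_eq_range_aeval] at ha
    exact ⟨p, rfl⟩
  simpa using lift_trdeg_le_of_surjective _ hsurj

/-- The field `K(x_g : g ∈ S_n)` contains the rational function field in `n` variables on which
`S_n` acts by permuting the variables. -/
lemma exists_equivariant_algebraicIndependent (K : Type*) [Field K] (n : ℕ) [NeZero n] :
    ∃ y : Fin n → FnField K (Equiv.Perm (Fin n)), AlgebraicIndependent K y ∧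
      ∀ σ i, galAction K (Equiv.Perm (Fin n)) σ (y i) = y (σ i) := by
  let p : Fin n → MvPolynomial (Equiv.Perm (Fin n)) K := fun i ↦
    ∑ g : Equiv.Perm (Fin n), if g 0 = i then X g else 0
  have hp : AlgebraicIndependent K p := by
    let f : MvPolynomial (Equiv.Perm (Fin n)) K →ₐ[K] MvPolynomial (Fin n) K :=
      aeval fun g ↦ if g = Equiv.swap 0 (g 0) then X (g 0) else 0
    refine AlgebraicIndependent.of_comp f ?_
    have : f ∘ p = X := by
      ext1 i
      simp only [Function.comp_apply, p, map_sum]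
      rw [Finset.sum_eq_single (Equiv.swap 0 i)]
      · simp [f]
      · intro g _ hg
        split_ifs with h
        · subst h
          simp [f, hg]
        · simp
      · simp
    rw [this]
    exact algebraicIndependent_X _ _
  refine ⟨fun i ↦ algebraMap _ _ (p i),
    hp.map' (f := IsScalarTower.toAlgHom K _ (FnField K (Equiv.Perm (Fin n))))
      (IsFractionRing.injective _ _), fun σ i ↦ ?_⟩
  rw [galAction_apply, permGalAction_algebraMap]
  congr 1
  simp only [p, map_sum]
  refine Fintype.sum_equiv (Equiv.mulLeft σ) _ _ fun g ↦ ?_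
  simp only [Equiv.coe_mulLeft, Equiv.Perm.mul_apply, σ.injective.eq_iff]
  split_ifs <;> simp

lemma AlgebraicIndependent.notMem_adjoin_image {K L σ : Type*} [Field K] [Field L] [Algebra K L]
    {y : σ → L} (hy : AlgebraicIndependent K y) {s : Set σ} {i : σ} (hi : i ∉ s) :
    y i ∉ IntermediateField.adjoin K (y '' s) := fun h ↦
  IntermediateField.transcendental_adjoin_iff.mpr (hy.transcendental_adjoin hi)
    (isAlgebraic_algebraMap (⟨y i, h⟩ : IntermediateField.adjoin K (y '' s)))

/-- The field generated by a family which is permuted by the group. -/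
lemma IntermediateField.apply_mem_adjoin_range {K L ι : Type*} [Field K] [Field L] [Algebra K L]
    (τ : L ≃ₐ[K] L) {f : ι → L} (hτ : ∀ i, ∃ j, τ (f i) = f j) {x : L}
    (hx : x ∈ IntermediateField.adjoin K (Set.range f)) :
    τ x ∈ IntermediateField.adjoin K (Set.range f) := by
  have : IntermediateField.adjoin K (Set.range f) ≤
      (IntermediateField.adjoin K (Set.range f)).comap (τ : L →ₐ[K] L) := by
    rw [IntermediateField.adjoin_le_iff]
    rintro _ ⟨i, rfl⟩
    obtain ⟨j, hj⟩ := hτ i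
    exact IntermediateField.subset_adjoin K _ ⟨j, hj.symm⟩
  exact this hx

/-- The symmetric group on at least three letters acts faithfully on the field generated
by the affine ratios of variables. -/
lemma exists_affine_subfield {K L : Type*} [Field K] [Field L] [Algebra K L] {m : ℕ}
    (ρ : Equiv.Perm (Fin (m + 3)) →* (L ≃ₐ[K] L)) {y : Fin (m + 3) → L}
    (hy : AlgebraicIndependent K y) (hρ : ∀ σ i, ρ σ (y i) = y (σ i)) :
    ∃ E : IntermediateField K L, (∀ σ, ∀ x ∈ E, ρ σ x ∈ E) ∧
      (∀ σ, σ ≠ 1 → ∃ x ∈ E, ρ σ x ≠ x) ∧ Algebra.trdeg K E ≤ (m + 1 : ℕ) := by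
  let T : Fin (m + 3) × Fin (m + 3) × Fin (m + 3) → L := fun t ↦
    (y t.1 - y t.2.1) / (y t.2.2 - y t.2.1)
  have hsub : ∀ {i j}, i ≠ j → y i - y j ≠ 0 := fun h ↦
    sub_ne_zero.mpr fun h' ↦ h (hy.injective h')
  refine ⟨IntermediateField.adjoin K (Set.range T), fun σ x hx ↦
    IntermediateField.apply_mem_adjoin_range (ρ σ)
      (fun t ↦ ⟨(σ t.1, σ t.2.1, σ t.2.2), by simp [T, hρ]⟩) hx, fun σ hσ ↦ ?_, ?_⟩
  · by_contra! hfix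
    have hT : ∀ (i : Fin (m + 3)) (c : Fin (m + 3) → K),
        (c i - c 0) * (c (σ 1) - c (σ 0)) = (c (σ i) - c (σ 0)) * (c 1 - c 0) := by
      intro i c
      have h := hfix (T (i, 0, 1)) (IntermediateField.subset_adjoin K _ ⟨_, rfl⟩)
      simp only [T, map_div₀, map_sub, hρ] at h
      rw [div_eq_div_iff (hsub (σ.injective.ne (by simp))) (hsub (by simp))] at h
      have h' : (aeval y) ((X i - X 0) * (X (σ 1) - X (σ 0)) : MvPolynomial (Fin (m + 3)) K) =
          (aeval y) ((X (σ i) - X (σ 0)) * (X 1 - X 0) : MvPolynomial (Fin (m + 3)) K) := by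
        simp [h]
      simpa using congrArg (eval c) (hy h')
    have hge : ∀ i, i ≠ 0 → i ≠ 1 → σ 0 ≠ i ∧ σ 1 ≠ i := by
      intro i h0 h1
      have h01 := σ.injective.ne (zero_ne_one (α := Fin (m + 3)))
      have h := hT i (Pi.single i 1)
      simp only [Pi.single_apply, if_true, h0.symm, h1.symm, if_false, sub_zero, one_mul,
        mul_zero] at h
      constructor
      · rintro rfl
        simp [h01.symm] at h
      · rintro rfl
        simp [h01] at h
    have hσ0 : σ 0 = 0 := by
      by_contra h0
      have h1 : σ 0 = 1 := by
        by_contra h1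
        exact (hge _ h0 h1).1 rfl
      have h := hT 2 (Pi.single 1 1)
      have hv : ((2 : Fin (m + 3)) : ℕ) = 2 := Nat.mod_eq_of_lt (show 2 < m + 3 by omega)
      have h2 : σ 2 ≠ 1 := fun h ↦ absurd (σ.injective (h.trans h1.symm))
        (Fin.ne_of_val_ne (by rw [hv]; simp))
      have h3 : (2 : Fin (m + 3)) ≠ 1 := Fin.ne_of_val_ne (by rw [hv]; simp)
      simp [Pi.single_apply, h1, h2, h3] at h
    have hσ1 : σ 1 = 1 := by
      by_contra h1
      have h0 : σ 1 ≠ 0 := fun h ↦ by simpa using σ.injective (h.trans hσ0.symm)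
      exact (hge _ h0 h1).2 rfl
    refine hσ (Equiv.ext fun i ↦ ?_)
    by_cases hi0 : i = 0
    · rw [hi0, hσ0, Equiv.Perm.one_apply]
    by_cases hi1 : i = 1
    · rw [hi1, hσ1, Equiv.Perm.one_apply]
    have hi : σ i ≠ 0 := fun h ↦ hi0 (σ.injective (h.trans hσ0.symm))
    have h := hT i (fun k ↦ if k = 1 ∨ k = σ i then 1 else 0)
    by_contra hne
    simp [hσ0, hσ1, hi.symm, hi1] at h
    exact hne h.symm
  · refine IntermediateField.trdeg_le_of_le_adjoin
      (fun i : Fin (m + 1) ↦ T (i.succ.succ, 0, 1)) ?_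
    have hu : ∀ i, T (i, 0, 1) ∈ IntermediateField.adjoin K
        (Set.range fun i : Fin (m + 1) ↦ T (i.succ.succ, 0, 1)) := by
      refine Fin.cases ?_ (Fin.cases ?_ fun i ↦ IntermediateField.subset_adjoin K _ ⟨i, rfl⟩)
      · simp [T]
      · rw [show T (Fin.succ 0, 0, 1) = 1 from div_self (hsub (by simp))]
        exact one_mem _
    rw [IntermediateField.adjoin_le_iff]
    rintro _ ⟨⟨i, a, b⟩, rfl⟩
    have : T (i, a, b) = (T (i, 0, 1) - T (a, 0, 1)) / (T (b, 0, 1) - T (a, 0, 1)) := by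
      simp only [T]
      rw [← sub_div, ← sub_div, div_div_div_cancel_right₀ (hsub (by simp))]
      ring
    rw [this]
    exact div_mem (sub_mem (hu _) (hu _)) (sub_mem (hu _) (hu _))

/-- The symmetric group on at least five letters acts faithfully on the field generated by the
cross ratios of variables. -/
lemma exists_crossRatio_subfield {K L : Type*} [Field K] [Field L] [Algebra K L] {m : ℕ}
    (ρ : Equiv.Perm (Fin (m + 5)) →* (L ≃ₐ[K] L)) {y : Fin (m + 5) → L}
    (hy : AlgebraicIndependent K y) (hρ : ∀ σ i, ρ σ (y i) = y (σ i)) :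
    ∃ E : IntermediateField K L, (∀ σ, ∀ x ∈ E, ρ σ x ∈ E) ∧
      (∀ σ, σ ≠ 1 → ∃ x ∈ E, ρ σ x ≠ x) ∧ Algebra.trdeg K E ≤ (m + 2 : ℕ) := by
  let R : Fin (m + 5) → Fin (m + 5) → Fin (m + 5) → Fin (m + 5) → L := fun i j k l ↦
    ((y i - y j) * (y k - y l)) / ((y i - y l) * (y k - y j))
  let R' : Fin (m + 5) × Fin (m + 5) × Fin (m + 5) × Fin (m + 5) → L := fun t ↦
    R t.1 t.2.1 t.2.2.1 t.2.2.2
  have hR : ∀ σ i j k l, ρ σ (R i j k l) = R (σ i) (σ j) (σ k) (σ l) := by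
    simp [R, hρ]
  have hsub : ∀ {i j}, i ≠ j → y i - y j ≠ 0 := fun h ↦
    sub_ne_zero.mpr fun h' ↦ h (hy.injective h')
  refine ⟨IntermediateField.adjoin K (Set.range R'), fun σ x hx ↦
    IntermediateField.apply_mem_adjoin_range (ρ σ)
      (fun t ↦ ⟨(σ t.1, σ t.2.1, σ t.2.2.1, σ t.2.2.2), hR _ _ _ _ _⟩) hx,
      fun σ hσ ↦ ?_, ?_⟩
  · by_contra! hfix
    obtain ⟨i, hi⟩ : ∃ i, σ i ≠ i := by
      by_contra! h
      exact hσ (Equiv.ext h)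
    have hcard : 2 < (({i, σ i} : Finset (Fin (m + 5)))ᶜ).card := by
      have := Finset.card_le_two (a := i) (b := σ i)
      rw [Finset.card_compl, Fintype.card_fin]
      omega
    obtain ⟨a, ha, b, hb, c, hc, hab, hac, hbc⟩ := Finset.two_lt_card.mp hcard
    simp only [Finset.mem_compl, Finset.mem_insert, Finset.mem_singleton, not_or] at ha hb hc
    refine hy.notMem_adjoin_image (s := {σ i}ᶜ) (i := σ i) (by simp) ?_
    set F := IntermediateField.adjoin K (y '' {σ i}ᶜ)
    have hF : ∀ k, k ≠ σ i → y k ∈ F := fun k hk ↦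
      IntermediateField.subset_adjoin K _ ⟨k, hk, rfl⟩
    have hRF : R i a b c ∈ F := div_mem
      (mul_mem (sub_mem (hF _ hi.symm) (hF _ ha.2)) (sub_mem (hF _ hb.2) (hF _ hc.2)))
      (mul_mem (sub_mem (hF _ hi.symm) (hF _ hc.2)) (sub_mem (hF _ hb.2) (hF _ ha.2)))
    have hfix' : R (σ i) (σ a) (σ b) (σ c) = R i a b c := by
      rw [← hR]
      exact hfix _ (IntermediateField.subset_adjoin K _ ⟨(i, a, b, c), rfl⟩)
    set r := R i a b c
    have hA := hF (σ a) (σ.injective.ne ha.1)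
    have hB := hF (σ b) (σ.injective.ne hb.1)
    have hC := hF (σ c) (σ.injective.ne hc.1)
    have hne : ∀ {k l}, k ≠ l → y (σ k) - y (σ l) ≠ 0 := fun h ↦ hsub (σ.injective.ne h)
    rw [div_eq_iff (mul_ne_zero (hne (Ne.symm hc.1)) (hne hab.symm))] at hfix'
    have hcoeff : (y (σ b) - y (σ c)) - r * (y (σ b) - y (σ a)) ≠ 0 := fun h ↦
      mul_ne_zero (hne hac) (hne hbc) (by linear_combination (y (σ i) - y (σ c)) * h - hfix')
    have hsolve : y (σ i) = (y (σ a) * (y (σ b) - y (σ c)) - r * y (σ c) * (y (σ b) - y (σ a))) /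
        ((y (σ b) - y (σ c)) - r * (y (σ b) - y (σ a))) := by
      rw [eq_div_iff hcoeff]
      linear_combination hfix'
    rw [hsolve]
    exact div_mem (sub_mem (mul_mem hA (sub_mem hB hC))
      (mul_mem (mul_mem hRF hC) (sub_mem hB hA)))
      (sub_mem (sub_mem hB hC) (mul_mem hRF (sub_mem hB hA)))
  · refine IntermediateField.trdeg_le_of_le_adjoin
      (fun i : Fin (m + 2) ↦ R i.succ.succ.succ 0 1 2) ?_
    set F := IntermediateField.adjoin K
      (Set.range fun i : Fin (m + 2) ↦ R i.succ.succ.succ 0 1 2)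
    have hv : ((2 : Fin (m + 5)) : ℕ) = 2 := Nat.mod_eq_of_lt (show 2 < m + 5 by omega)
    have h10 : y 1 - y 0 ≠ 0 := hsub (by simp)
    have h02 : y 0 - y 2 ≠ 0 := hsub (Fin.ne_of_val_ne (by rw [hv]; simp))
    have h12 : y 1 - y 2 ≠ 0 := hsub (Fin.ne_of_val_ne (by rw [hv]; simp))
    have hw : ∀ i, R i 0 1 2 ∈ F := by
      refine Fin.cases ?_ (Fin.cases ?_ (Fin.cases ?_ fun i ↦
        IntermediateField.subset_adjoin K _ ⟨i, rfl⟩))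
      · simp [R]
      · rw [show R (Fin.succ 0) 0 1 2 = 1 by
          simp only [R, Fin.succ_zero_eq_one]
          rw [mul_comm, div_self (mul_ne_zero h12 h10)]]
        exact one_mem _
      · simp [R]
    let A : Fin (m + 5) → L := fun i ↦ if i = 2 then 1 else R i 0 1 2
    let B : Fin (m + 5) → L := fun i ↦ if i = 2 then 0 else 1
    let D : Fin (m + 5) → L := fun i ↦
      if i = 2 then (y 2 - y 0) * (y 1 - y 2) else (y i - y 2) * (y 1 - y 0)
    have hA : ∀ i, A i ∈ F := fun i ↦ by
      by_cases h : i = 2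
      · simp [A, h]
      · simpa [A, h] using hw i
    have hB : ∀ i, B i ∈ F := fun i ↦ by by_cases h : i = 2 <;> simp [B, h]
    have hD : ∀ i, D i ≠ 0 := fun i ↦ by
      by_cases h : i = 2
      · simp [D, h, h12, sub_ne_zero.mpr (sub_ne_zero.mp h02).symm]
      · simp [D, h, h10, hsub h]
    have hy' : ∀ i j, (A i * B j - A j * B i) * (D i * D j) =
        (y i - y j) * ((y 1 - y 2) * (y 1 - y 0) * (y 0 - y 2)) := by
      intro i j
      by_cases hi : i = 2 <;> by_cases hj : j = 2
      · simp [hi, hj]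
      · simp only [A, B, D, hi, hj, if_true, if_false]
        ring
      · simp only [A, B, D, hi, hj, if_true, if_false]
        ring
      · have := hsub hi
        have := hsub hj
        simp only [A, B, D, R, hi, hj, if_false]
        field_simp
        ring
    have hc : (y 1 - y 2) * (y 1 - y 0) * (y 0 - y 2) ≠ 0 := by simp [h10, h02, h12]
    rw [IntermediateField.adjoin_le_iff]
    rintro _ ⟨⟨i, j, k, l⟩, rfl⟩
    have : R' (i, j, k, l) = ((A i * B j - A j * B i) * (A k * B l - A l * B k)) /
        ((A i * B l - A l * B i) * (A k * B j - A j * B k)) := by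
      simp only [R', R]
      rw [← mul_div_mul_right _ _ (mul_ne_zero hc hc),
        ← mul_div_mul_right ((A i * B j - A j * B i) * (A k * B l - A l * B k)) _
          (mul_ne_zero (mul_ne_zero (hD i) (hD j)) (mul_ne_zero (hD k) (hD l)))]
      congr 1
      · linear_combination -(hy' i j) * (A k * B l - A l * B k) * (D k * D l) -
          (hy' k l) * (y i - y j) * ((y 1 - y 2) * (y 1 - y 0) * (y 0 - y 2))
      · linear_combination -(hy' i l) * (A k * B j - A j * B k) * (D k * D j) -
          (hy' k j) * (y i - y l) * ((y 1 - y 2) * (y 1 - y 0) * (y 0 - y 2))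
    rw [this]
    have hAB : ∀ i j, A i * B j - A j * B i ∈ F := fun i j ↦
      sub_mem (mul_mem (hA i) (hB j)) (mul_mem (hA j) (hB i))
    exact div_mem (mul_mem (hAB i j) (hAB k l)) (mul_mem (hAB i l) (hAB k j))

/-- The symmetric group on two letters acts faithfully on the field generated by the ratio of the
two variables. -/
lemma exists_ratio_subfield {K L : Type*} [Field K] [Field L] [Algebra K L]
    (ρ : Equiv.Perm (Fin 2) →* (L ≃ₐ[K] L)) {y : Fin 2 → L}
    (hy : AlgebraicIndependent K y) (hρ : ∀ σ i, ρ σ (y i) = y (σ i)) :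
    ∃ E : IntermediateField K L, (∀ σ, ∀ x ∈ E, ρ σ x ∈ E) ∧
      (∀ σ, σ ≠ 1 → ∃ x ∈ E, ρ σ x ≠ x) ∧ Algebra.trdeg K E ≤ (1 : ℕ) := by
  let f : Fin 2 → L := fun i ↦ y i / y (i + 1)
  refine ⟨IntermediateField.adjoin K (Set.range f), fun σ x hx ↦
    IntermediateField.apply_mem_adjoin_range (ρ σ) (fun i ↦ ⟨σ i, ?_⟩) hx, fun σ hσ ↦ ?_, ?_⟩
  · have : ∀ (σ : Equiv.Perm (Fin 2)) i, σ (i + 1) = σ i + 1 := by decide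
    simp [f, hρ, this]
  · refine ⟨f 0, IntermediateField.subset_adjoin K _ ⟨0, rfl⟩, fun h ↦ ?_⟩
    have h01 : ∀ σ : Equiv.Perm (Fin 2), σ ≠ 1 → σ 0 = 1 ∧ σ 1 = 0 := by decide
    simp only [f, zero_add, map_div₀, hρ, h01 σ hσ] at h
    rw [div_eq_div_iff (hy.ne_zero _) (hy.ne_zero _)] at h
    have h' : (aeval y) (X 1 * X 1 : MvPolynomial (Fin 2) K) =
        (aeval y) (X 0 * X 0 : MvPolynomial (Fin 2) K) := by
      simp [h]
    simpa using congrArg (eval (Pi.single 0 1)) (hy h')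
  · refine IntermediateField.trdeg_le_of_le_adjoin (fun _ : Fin 1 ↦ f 0) ?_
    rw [IntermediateField.adjoin_le_iff]
    have h0 : f 0 ∈ IntermediateField.adjoin K (Set.range fun _ : Fin 1 ↦ f 0) :=
      IntermediateField.subset_adjoin K _ ⟨0, rfl⟩
    rintro _ ⟨i, rfl⟩
    fin_cases i
    · exact h0
    · simpa [f] using inv_mem h0

lemma edK_eq_of_bounds {K G : Type*} [Field K] [Group G] {d : ℕ}
    (hle : ∃ E : IntermediateField K (FnField K G),
      (∀ g, ∀ x ∈ E, galAction K G g x ∈ E) ∧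
      (∀ g, g ≠ 1 → ∃ x ∈ E, galAction K G g x ≠ x) ∧ Algebra.trdeg K E ≤ d)
    (hge : ∀ E : IntermediateField K (FnField K G),
      (∀ g, ∀ x ∈ E, galAction K G g x ∈ E) →
      (∀ g, g ≠ 1 → ∃ x ∈ E, galAction K G g x ≠ x) → (d : Cardinal) ≤ trdeg K E) :
    edK K G = d := by
  refine IsLeast.csInf_eq ⟨?_, ?_⟩
  · obtain ⟨E, hst, hf, hE⟩ := hle
    exact ⟨E, hst, hf, le_antisymm (by rwa [trdeg_eq]) (hge E hst hf)⟩
  · rintro d' ⟨E, hst, hf, hE⟩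
    exact Nat.cast_le.mp (hE ▸ hge E hst hf)

/-- Over any field, a symmetric group on at least four letters has essential dimension at least
two. -/
lemma two_le_trdeg_symmGroup {K : Type*} [Field K] {n : ℕ} (hn : 4 ≤ n)
    {g : Equiv.Perm (Fin n)} (hg4 : g ^ 4 = 1) (hg2 : g ^ 2 ≠ 1)
    (E : IntermediateField K (FnField K (Equiv.Perm (Fin n))))
    (hst : ∀ g, ∀ x ∈ E, galAction K _ g x ∈ E)
    (hf : ∀ g, g ≠ 1 → ∃ x ∈ E, galAction K _ g x ≠ x) :
    ((2 : ℕ) : Cardinal) ≤ trdeg K E := by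
  by_cases h2 : (2 : K) = 0
  · exact_mod_cast two_le_trdeg_of_pow_four h2 hg4 hg2 E hst hf
  · obtain ⟨ρ, hρ⟩ := exists_elementary_two_hom (r := 2) hn
    exact le_trdeg_of_elementary_two h2 ρ hρ E hst hf

/-- `ed_K(S₂) = ed_K(S₃) = 1`, `ed_K(S₄) = ed_K(S₅) = 2` for an arbitrary field `K`,
and `ed_K(S₆) = 3` if `char K ≠ 2`. -/
theorem edK_symmGroup_small (K : Type*) [Field K] :
    edK K (Equiv.Perm (Fin 2)) = 1 ∧ edK K (Equiv.Perm (Fin 3)) = 1 ∧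
    edK K (Equiv.Perm (Fin 4)) = 2 ∧ edK K (Equiv.Perm (Fin 5)) = 2 ∧
    (ringChar K ≠ 2 → edK K (Equiv.Perm (Fin 6)) = 3) := by
  refine ⟨edK_eq_of_bounds ?_ fun E _ hf ↦ by exact_mod_cast one_le_trdeg E hf,
    edK_eq_of_bounds ?_ fun E _ hf ↦ by exact_mod_cast one_le_trdeg E hf,
    edK_eq_of_bounds ?_ (two_le_trdeg_symmGroup le_rfl (g := finRotate 4) (by decide) (by decide)),
    edK_eq_of_bounds ?_ (two_le_trdeg_symmGroup (by norm_num)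
      (g := Equiv.swap 0 1 * Equiv.swap 1 2 * Equiv.swap 2 3) (by decide) (by decide)),
    fun hK ↦ edK_eq_of_bounds ?_ fun E hst hf ↦ ?_⟩
  · obtain ⟨y, hy, hρ⟩ := exists_equivariant_algebraicIndependent K 2
    exact exists_ratio_subfield _ hy hρ
  · obtain ⟨y, hy, hρ⟩ := exists_equivariant_algebraicIndependent K 3
    exact exists_affine_subfield (m := 0) _ hy hρ
  · obtain ⟨y, hy, hρ⟩ := exists_equivariant_algebraicIndependent K 4
    exact exists_affine_subfield (m := 1) _ hy hρ
  · obtain ⟨y, hy, hρ⟩ := exists_equivariant_algebraicIndependent K 5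
    exact exists_crossRatio_subfield (m := 0) _ hy hρ
  · obtain ⟨y, hy, hρ⟩ := exists_equivariant_algebraicIndependent K 6
    exact exists_crossRatio_subfield (m := 1) _ hy hρ
  · obtain ⟨ρ, hρ⟩ := exists_elementary_two_hom (r := 3) (n := 6) le_rfl
    exact le_trdeg_of_elementary_two (Ring.two_ne_zero hK) ρ hρ E hst hf
end
end

section
/- Let K be a field with char K ≠ 2. Then for every integer n ≥ 1, ed_K(S_{n+2}) ≥ ed_K(S_n) + 1, and consequently ed_K(S_n) ≥ ⌊n/2⌋ for every integer n ≥ 1. -/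
noncomputable section

section Transcendence

universe u

variable {K : Type*} [Field K]

theorem trdeg_add_one_le_of_not_injective {R S : Type u} [CommRing R] [IsDomain R] [CommRing S]
    [IsDomain S] [Algebra K R] [Algebra K S] {f : R →ₐ[K] S} (hf : Function.Surjective f)
    {a : R} (ha : a ≠ 0) (hfa : f a = 0) :
    Algebra.trdeg K S + 1 ≤ Algebra.trdeg K R := by
  obtain ⟨s, hs⟩ := exists_isTranscendenceBasis K S
  set x : s → R := fun i => Function.surjInv hf i with hxdef
  have hfx : f ∘ x = Subtype.val := funext fun i => Function.surjInv_eq hf _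
  have hx : AlgebraicIndependent K x := AlgebraicIndependent.of_comp f (hfx ▸ hs.1)
  have htr : Transcendental (Algebra.adjoin K (Set.range x)) a := by
    intro halg
    obtain ⟨q, hq0, hq⟩ :=
      halg.exists_nonzero_coeff_and_aeval_eq_zero (mem_nonZeroDivisors_of_ne_zero ha)
    apply hq0
    have hc : f (q.coeff 0 : R) = 0 := by
      rw [← Polynomial.divX_mul_X_add q] at hq
      have := congrArg f hq
      simpa [hfa, Subalgebra.algebraMap_def] using this
    obtain ⟨P, hP⟩ : ∃ P, MvPolynomial.aeval x P = (q.coeff 0 : R) := by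
      have h : ((q.coeff 0 : Algebra.adjoin K (Set.range x)) : R) ∈ (MvPolynomial.aeval x).range :=
        (Algebra.adjoin_range_eq_range_aeval K x).le (q.coeff 0).2
      exact h
    have hP0 : P = 0 := by
      apply (injective_iff_map_eq_zero _).1 hs.1
      rw [← hfx]
      exact (MvPolynomial.comp_aeval_apply (f := x) f P).symm.trans (by rw [hP, hc])
    apply Subtype.ext
    rw [← hP, hP0, map_zero]
    rfl
  have := ((hx.option_iff_transcendental a).2 htr).cardinalMk_le_trdeg
  rw [Cardinal.mk_option] at this
  rwa [← hs.cardinalMk_eq_trdeg]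

open scoped IntermediateField.algebraAdjoinAdjoin in
theorem trdeg_intermediateField_adjoin {L : Type*} [Field L] [Algebra K L] (S : Set L) :
    Algebra.trdeg K (IntermediateField.adjoin K S) = Algebra.trdeg K (Algebra.adjoin K S) := by
  rw [← _root_.trdeg_add_eq K (Algebra.adjoin K S),
    trdeg_eq_zero (R := Algebra.adjoin K S), add_zero]

end Transcendence

section Specialization

variable {K L Γ G : Type*} [Field K] [Field L] [Algebra K L]
  [Group Γ] [Finite Γ] [Group G] [Finite G]

theorem span_equivariant_eq_top (ι : Γ →* G) (ρ : Γ →* (L ≃ₐ[K] L))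
    (hρ : Function.Injective ρ) :
    Submodule.span L {u : G → L | ∀ γ g, u (ι γ * g) = ρ γ (u g)} = ⊤ := by
  classical
  have := Fintype.ofFinite G
  have := Fintype.ofFinite Γ
  by_contra hne
  obtain ⟨ℓ, hℓ0, hℓ⟩ := Submodule.exists_le_ker_of_lt_top _ (lt_top_iff_ne_top.2 hne)
  apply hℓ0
  refine LinearMap.pi_ext' fun g₀ => LinearMap.ext_ring ?_
  have hli := (linearIndependent_monoidHom L L).comp
    (fun γ : Γ => ((ρ γ : L →ₐ[K] L) : L →* L)) (by
      intro γ γ' h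
      apply hρ
      ext y
      exact DFunLike.congr_fun h y)
  rw [Fintype.linearIndependent_iff] at hli
  have key := hli (fun γ => ℓ (Pi.single (ι γ * g₀) 1)) (by
    funext y
    let u : G → L := ∑ γ, Pi.single (ι γ * g₀) (ρ γ y)
    have hu : ∀ γ g, u (ι γ * g) = ρ γ (u g) := by
      intro γ g
      simp only [u, Finset.sum_apply, map_sum]
      refine (Fintype.sum_equiv (Equiv.mulLeft γ) _ _ fun δ => ?_).symm
      simp only [Pi.single_apply, Equiv.coe_mulLeft, map_mul, mul_assoc, mul_right_inj]
      split_ifs <;> simp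
    have := hℓ (Submodule.subset_span hu)
    rw [LinearMap.mem_ker] at this
    simp only [u, map_sum] at this
    rw [Finset.sum_apply, Pi.zero_apply, ← this]
    refine Finset.sum_congr rfl fun γ _ => ?_
    have h1 : Pi.single (ι γ * g₀) (ρ γ y) = ρ γ y • (Pi.single (ι γ * g₀) 1 : G → L) := by
      rw [← Pi.single_smul, smul_eq_mul, mul_one]
    rw [h1, map_smul]
    simp [mul_comm]) 1
  simpa using key

variable [Infinite L]

theorem infinite_fixedPoints (ρ : Γ →* (L ≃ₐ[K] L)) :
    {c : L | ∀ γ, ρ γ c = c}.Infinite := by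
  have : Finite ρ.range := Set.finite_range ρ
  have h : Infinite (FixedPoints.subfield ρ.range L) := by
    by_contra hfin
    rw [not_infinite_iff_finite] at hfin
    exact not_finite_iff_infinite.2 ‹Infinite L›
      (Module.finite_of_finite (FixedPoints.subfield ρ.range L))
  refine (Set.infinite_coe_iff.1 h).mono fun c hc γ =>
    (show c ∈ FixedPoints.subfield ρ.range L from hc) ⟨ρ γ, γ, rfl⟩

theorem exists_equivariant_aeval_ne_zero (ι : Γ →* G)
    (ρ : Γ →* (L ≃ₐ[K] L)) (hρ : Function.Injective ρ) {f : MvPolynomial G K} (hf : f ≠ 0) :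
    ∃ u : G → L, (∀ γ g, u (ι γ * g) = ρ γ (u g)) ∧ MvPolynomial.aeval u f ≠ 0 := by
  classical
  have hf' : MvPolynomial.map (algebraMap K L) f ≠ 0 :=
    (map_ne_zero_iff _ (MvPolynomial.map_injective _ (algebraMap K L).injective)).2 hf
  obtain ⟨p, hp⟩ : ∃ p : G → L, MvPolynomial.aeval p f ≠ 0 := by
    by_contra! h
    apply hf'
    refine MvPolynomial.funext fun p => ?_
    rw [MvPolynomial.eval_map, ← MvPolynomial.aeval_def, h, map_zero]
  have hpspan : p ∈ Submodule.span L {u : G → L | ∀ γ g, u (ι γ * g) = ρ γ (u g)} := by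
    rw [span_equivariant_eq_top ι ρ hρ]; trivial
  rw [Submodule.mem_span_set] at hpspan
  obtain ⟨c, hc, rfl⟩ := hpspan
  let q : MvPolynomial c.support L := MvPolynomial.aeval
    (fun g => ∑ w : c.support, MvPolynomial.X w * MvPolynomial.C ((w : G → L) g)) f
  have hq (b : c.support → L) : MvPolynomial.eval b q =
      MvPolynomial.aeval (fun g => ∑ w : c.support, b w * (w : G → L) g) f := by
    have := MvPolynomial.comp_aeval_apply (R := K)
      (φ := (MvPolynomial.aeval b : MvPolynomial c.support L →ₐ[L] L).restrictScalars K)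
      (f := fun g => ∑ w : c.support, MvPolynomial.X w * MvPolynomial.C ((w : G → L) g)) f
    rw [AlgHom.restrictScalars_apply, MvPolynomial.aeval_eq_eval] at this
    rw [this]
    congr 2
    funext g
    simp
  have hq0 : q ≠ 0 := by
    intro h0
    apply hp
    have := hq (fun w => c w)
    rw [h0, map_zero] at this
    rw [this]
    congr 2
    funext g
    rw [Finsupp.sum, Finset.sum_apply, ← Finset.sum_coe_sort]
    simp
  by_contra! hall
  apply hq0
  refine MvPolynomial.funext_set (fun _ => {c : L | ∀ γ, ρ γ c = c})
    (fun _ => infinite_fixedPoints ρ) fun b hb => ?_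
  rw [hq, map_zero]
  apply hall
  intro γ g
  rw [map_sum]
  refine Finset.sum_congr rfl fun w _ => ?_
  rw [map_mul, hb w trivial γ, hc w.2 γ g]

end Specialization

section LaurentSeries

variable {K F : Type*} [Field K] [Field F] [Algebra K F]

open HahnSeries

theorem algebraMap_hahnSeries_eq_C (r : K) :
    algebraMap K (HahnSeries ℤ F) r = C (algebraMap K F r) := by
  rw [HahnSeries.algebraMap_apply', PowerSeries.algebraMap_apply, ofPowerSeries_C]

/-- The endomorphism of `F((t))` acting on coefficients through `h` and sending `t` to `ε t`. -/
def laurentTwistHom (h : F ≃ₐ[K] F) (ε : ℤˣ) : HahnSeries ℤ F →ₐ[K] HahnSeries ℤ F where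
  toFun x :=
    { coeff := fun n => (((ε ^ n : ℤˣ) : ℤ) : F) * h (x.coeff n)
      isPWO_support' := x.isPWO_support.mono fun n hn hx => hn (by simp [hx]) }
  map_one' := by
    ext n
    by_cases hn : n = 0 <;> simp [coeff_one, hn]
  map_mul' x y := by
    ext n
    have hu (n : ℤ) : (((ε ^ n : ℤˣ) : ℤ) : F) ≠ 0 := by
      rcases Int.units_eq_one_or (ε ^ n) with h | h <;> simp [h]
    rw [coeff_mul]
    simp only
    rw [coeff_mul, map_sum, Finset.mul_sum]
    refine Finset.sum_congr ?_ fun ij hij => ?_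
    · ext ij
      simp [hu]
    · rw [← (Finset.mem_antidiagonal.1 hij).2.2, zpow_add, map_mul]
      push_cast
      ring
  map_zero' := by ext; simp
  map_add' x y := by ext; simp [mul_add]
  commutes' r := by
    ext n
    by_cases hn : n = 0 <;> simp [algebraMap_hahnSeries_eq_C, C_apply, hn]

theorem laurentTwistHom_coeff (h : F ≃ₐ[K] F) (ε : ℤˣ) (x : HahnSeries ℤ F) (n : ℤ) :
    (laurentTwistHom h ε x).coeff n = (((ε ^ n : ℤˣ) : ℤ) : F) * h (x.coeff n) := rfl

theorem laurentTwistHom_one : laurentTwistHom (1 : F ≃ₐ[K] F) 1 = AlgHom.id K _ := by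
  ext x n
  simp [laurentTwistHom_coeff]

theorem laurentTwistHom_mul (h h' : F ≃ₐ[K] F) (ε ε' : ℤˣ) :
    laurentTwistHom (h * h') (ε * ε') = (laurentTwistHom h ε).comp (laurentTwistHom h' ε') := by
  ext x n
  simp [laurentTwistHom_coeff, mul_zpow, mul_assoc]

/-- The action of `Aut_K(F) × {±1}` on `F((t))`, through coefficients and by `t ↦ ± t`. -/
def laurentTwist : (F ≃ₐ[K] F) × ℤˣ →* (HahnSeries ℤ F ≃ₐ[K] HahnSeries ℤ F) where
  toFun g := AlgEquiv.ofAlgHom (laurentTwistHom g.1 g.2) (laurentTwistHom g.1⁻¹ g.2⁻¹)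
    (by rw [← laurentTwistHom_mul, mul_inv_cancel, mul_inv_cancel, laurentTwistHom_one])
    (by rw [← laurentTwistHom_mul, inv_mul_cancel, inv_mul_cancel, laurentTwistHom_one])
  map_one' := AlgEquiv.ext fun x => DFunLike.congr_fun laurentTwistHom_one x
  map_mul' g g' := AlgEquiv.ext fun x =>
    DFunLike.congr_fun (laurentTwistHom_mul g.1 g'.1 g.2 g'.2) x

theorem laurentTwist_coeff (g : (F ≃ₐ[K] F) × ℤˣ) (x : HahnSeries ℤ F) (n : ℤ) :
    (laurentTwist g x).coeff n = (((g.2 ^ n : ℤˣ) : ℤ) : F) * g.1 (x.coeff n) := rfl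

theorem laurentTwist_injective (h2 : (2 : F) ≠ 0) :
    Function.Injective (laurentTwist : (F ≃ₐ[K] F) × ℤˣ →* _) := by
  rw [injective_iff_map_eq_one]
  rintro ⟨h, ε⟩ hg
  have h1 (x : HahnSeries ℤ F) (n : ℤ) :
      (((ε ^ n : ℤˣ) : ℤ) : F) * h (x.coeff n) = x.coeff n :=
    (laurentTwist_coeff (h, ε) x n).symm.trans (by rw [hg]; rfl)
  have hε : ε = 1 := by
    have := h1 (single 1 1) 1
    rcases Int.units_eq_one_or ε with rfl | rfl
    · rfl
    · simp only [zpow_one, coeff_single_same, map_one, mul_one, Units.val_neg, Units.val_one,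
        Int.cast_neg, Int.cast_one] at this
      exact absurd (by linear_combination -this) h2
  subst hε
  refine Prod.ext (AlgEquiv.ext fun y => ?_) rfl
  simpa using h1 (single 0 y) 0

theorem order_laurentTwist (g : (F ≃ₐ[K] F) × ℤˣ) {x : HahnSeries ℤ F} (hx : x ≠ 0) :
    (laurentTwist g x).order = x.order := by
  have hgx : laurentTwist g x ≠ 0 := (map_ne_zero_iff _ (laurentTwist g).injective).2 hx
  have hu (n : ℤ) : (((g.2 ^ n : ℤˣ) : ℤ) : F) ≠ 0 := by
    rcases Int.units_eq_one_or (g.2 ^ n) with h | h <;> simp [h]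
  have hc (n : ℤ) : (laurentTwist g x).coeff n = 0 ↔ x.coeff n = 0 := by
    rw [laurentTwist_coeff, mul_eq_zero, or_iff_right (hu n), map_eq_zero_iff _ g.1.injective]
  apply le_antisymm
  · exact order_le_of_coeff_ne_zero ((hc _).not.2 (coeff_order_eq_zero.not.2 hx))
  · exact order_le_of_coeff_ne_zero ((hc _).not.1 (coeff_order_eq_zero.not.2 hgx))

theorem leadingCoeff_laurentTwist (g : (F ≃ₐ[K] F) × ℤˣ) (x : HahnSeries ℤ F) :
    (laurentTwist g x).leadingCoeff = (((g.2 ^ x.order : ℤˣ) : ℤ) : F) * g.1 x.leadingCoeff := by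
  by_cases hx : x = 0
  · simp [hx]
  · rw [leadingCoeff_eq, order_laurentTwist g hx, laurentTwist_coeff, leadingCoeff_eq]

theorem order_inv_of_ne_zero {x : HahnSeries ℤ F} (hx : x ≠ 0) : x⁻¹.order = -x.order := by
  have := order_mul hx (inv_ne_zero hx)
  rw [mul_inv_cancel₀ hx, order_one] at this
  omega

theorem order_zpow_of_ne_zero {x : HahnSeries ℤ F} (hx : x ≠ 0) (n : ℤ) :
    (x ^ n).order = n * x.order := by
  cases n with
  | ofNat n => simp
  | negSucc n =>
    rw [zpow_negSucc, order_inv_of_ne_zero (pow_ne_zero _ hx), order_pow, Int.negSucc_eq]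
    simp only [nsmul_eq_mul]
    push_cast
    ring

theorem exists_ofPowerSeries_eq {x : HahnSeries ℤ F} (hx : 0 ≤ x.order) :
    ∃ p : PowerSeries F, ofPowerSeries ℤ F p = x ∧ PowerSeries.constantCoeff p = x.coeff 0 := by
  obtain ⟨n, hn⟩ := Int.eq_ofNat_of_zero_le hx
  have h := LaurentSeries.X_order_mul_powerSeriesPart hn.symm
  refine ⟨_, h, ?_⟩
  rw [← PowerSeries.coeff_zero_eq_constantCoeff_apply, ← LaurentSeries.coeff_coe_powerSeries, h]
  rfl

end LaurentSeries

section Residue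

open HahnSeries

variable {K F : Type*} [Field K] [Field F] [Algebra K F]

/-- The power series lying in a subfield of `F((t))`. -/
def integralPart (E : IntermediateField K (HahnSeries ℤ F)) : Subalgebra K (PowerSeries F) :=
  { E.toSubfield.toSubring.comap (ofPowerSeries ℤ F) with
    algebraMap_mem' := fun r => by
      change ofPowerSeries ℤ F (algebraMap K (PowerSeries F) r) ∈ E
      rw [PowerSeries.algebraMap_apply, ofPowerSeries_C, ← algebraMap_hahnSeries_eq_C]
      exact E.algebraMap_mem r }

theorem mem_integralPart {E : IntermediateField K (HahnSeries ℤ F)} {p : PowerSeries F} :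
    p ∈ integralPart E ↔ ofPowerSeries ℤ F p ∈ E := Iff.rfl

/-- The residue field of a subfield of `F((t))`. -/
def residueSubfield (E : IntermediateField K (HahnSeries ℤ F)) : IntermediateField K F where
  carrier := {r | ∃ p ∈ integralPart E, PowerSeries.constantCoeff p = r}
  mul_mem' := by
    rintro _ _ ⟨p, hp, rfl⟩ ⟨q, hq, rfl⟩
    exact ⟨p * q, mul_mem hp hq, map_mul _ _ _⟩
  add_mem' := by
    rintro _ _ ⟨p, hp, rfl⟩ ⟨q, hq, rfl⟩
    exact ⟨p + q, add_mem hp hq, map_add _ _ _⟩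
  algebraMap_mem' r := ⟨algebraMap K _ r, (integralPart E).algebraMap_mem r, by
    rw [PowerSeries.algebraMap_apply, PowerSeries.constantCoeff_C]⟩
  inv_mem' := by
    rintro _ ⟨p, hp, rfl⟩
    by_cases h : PowerSeries.constantCoeff p = 0
    · exact ⟨0, zero_mem _, by simp [h]⟩
    · refine ⟨p⁻¹, ?_, PowerSeries.constantCoeff_inv p⟩
      have : ofPowerSeries ℤ F p⁻¹ = (ofPowerSeries ℤ F p)⁻¹ := by
        refine eq_inv_of_mul_eq_one_left ?_
        rw [← map_mul, PowerSeries.inv_mul_cancel p h, map_one]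
      rw [mem_integralPart, this]
      exact E.inv_mem hp

theorem coeff_zero_mem_residueSubfield {E : IntermediateField K (HahnSeries ℤ F)}
    {x : HahnSeries ℤ F} (hx : x ∈ E) (h0 : 0 ≤ x.order) : x.coeff 0 ∈ residueSubfield E := by
  obtain ⟨p, hp, hp'⟩ := exists_ofPowerSeries_eq h0
  exact ⟨p, mem_integralPart.2 (hp ▸ hx), hp'⟩

theorem exists_coeff_zero_eq_of_mem_residueSubfield {E : IntermediateField K (HahnSeries ℤ F)}
    {r : F} (hr : r ∈ residueSubfield E) : ∃ x ∈ E, 0 ≤ x.order ∧ x.coeff 0 = r := by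
  obtain ⟨p, hp, rfl⟩ := hr
  refine ⟨_, hp, ?_, ?_⟩
  · by_contra! h
    have hne : ofPowerSeries ℤ F p ≠ 0 := fun h0 => by simp [h0] at h
    apply coeff_order_eq_zero.not.2 hne
    rw [PowerSeries.coeff_coe, if_pos h]
  · exact (LaurentSeries.coeff_coe_powerSeries p 0).trans
      (PowerSeries.coeff_zero_eq_constantCoeff_apply p)

theorem trdeg_residueSubfield_add_one_le {E : IntermediateField K (HahnSeries ℤ F)}
    {x : HahnSeries ℤ F} (hx : x ∈ E) (hx0 : x ≠ 0) (hord : x.order ≠ 0) :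
    Algebra.trdeg K (residueSubfield E) + 1 ≤ Algebra.trdeg K E := by
  wlog hpos : 0 < x.order generalizing x
  · refine this (E.inv_mem hx) (inv_ne_zero hx0) ?_ ?_ <;> rw [order_inv_of_ne_zero hx0] <;> omega
  obtain ⟨p, hp, hp'⟩ := exists_ofPowerSeries_eq hpos.le
  rw [coeff_eq_zero_of_lt_order hpos] at hp'
  let f : integralPart E →ₐ[K] residueSubfield E :=
    { ((PowerSeries.constantCoeff (R := F)).comp (integralPart E).val.toRingHom).codRestrict
        (residueSubfield E).toSubfield (fun q => ⟨q, q.2, rfl⟩) with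
      commutes' := fun r => Subtype.ext (by
        change PowerSeries.constantCoeff (algebraMap K (PowerSeries F) r) = _
        rw [PowerSeries.algebraMap_apply, PowerSeries.constantCoeff_C]
        rfl) }
  have hf : Function.Surjective f := by
    rintro ⟨_, q, hq, rfl⟩
    exact ⟨⟨q, hq⟩, rfl⟩
  refine (trdeg_add_one_le_of_not_injective hf
    (a := ⟨p, mem_integralPart.2 (hp ▸ hx)⟩) ?_ (Subtype.ext hp')).trans ?_
  · intro h
    apply hx0
    rw [← hp, show p = 0 from congrArg Subtype.val h, map_zero]
  let g : integralPart E →ₐ[K] E :=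
    { ((ofPowerSeries ℤ F).comp (integralPart E).val.toRingHom).codRestrict
        E.toSubfield (fun q => q.2) with
      commutes' := fun r => Subtype.ext (by
        change ofPowerSeries ℤ F (algebraMap K (PowerSeries F) r) = _
        rw [PowerSeries.algebraMap_apply, ofPowerSeries_C, ← algebraMap_hahnSeries_eq_C]
        rfl) }
  refine _root_.trdeg_le_of_injective g fun a b hab => Subtype.ext ?_
  exact ofPowerSeries_injective (congrArg Subtype.val hab)

theorem residueSubfield_stable {E : IntermediateField K (HahnSeries ℤ F)} {h : F ≃ₐ[K] F}
    (hE : ∀ x ∈ E, laurentTwist (h, 1) x ∈ E) {r : F} (hr : r ∈ residueSubfield E) :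
    h r ∈ residueSubfield E := by
  obtain ⟨x, hx, hx0, rfl⟩ := exists_coeff_zero_eq_of_mem_residueSubfield hr
  by_cases h0 : x = 0
  · simp [h0, zero_mem]
  have := coeff_zero_mem_residueSubfield (hE x hx) (by rwa [order_laurentTwist _ h0])
  simpa [laurentTwist_coeff] using this

theorem odd_order_of_twist_eq_neg (h2 : (2 : F) ≠ 0) {x : HahnSeries ℤ F} (hx0 : x ≠ 0)
    (hx : laurentTwist ((1 : F ≃ₐ[K] F), (-1 : ℤˣ)) x = -x) : Odd x.order := by
  by_contra hodd
  rw [Int.not_odd_iff_even] at hodd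
  have := leadingCoeff_laurentTwist ((1 : F ≃ₐ[K] F), (-1 : ℤˣ)) x
  rw [hx, leadingCoeff_neg, hodd.neg_one_zpow] at this
  simp only [Units.val_one, Int.cast_one, one_mul, AlgEquiv.one_apply] at this
  refine mul_ne_zero h2 (leadingCoeff_ne_zero.2 hx0) ?_
  linear_combination -this

theorem exists_twist_eq_neg {E : IntermediateField K (HahnSeries ℤ F)}
    {g : (F ≃ₐ[K] F) × ℤˣ} (hgg : g * g = 1) (hE : ∀ x ∈ E, laurentTwist g x ∈ E)
    (hne : ∃ x ∈ E, laurentTwist g x ≠ x) :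
    ∃ x ∈ E, x ≠ 0 ∧ laurentTwist g x = -x := by
  obtain ⟨x, hx, hne⟩ := hne
  refine ⟨laurentTwist g x - x, sub_mem (hE x hx) hx, sub_ne_zero.2 hne, ?_⟩
  have : laurentTwist g (laurentTwist g x) = x := by
    rw [← AlgEquiv.mul_apply, ← map_mul, hgg, map_one, AlgEquiv.one_apply]
  rw [map_sub, this, neg_sub]

theorem twist_contradiction (h2 : (2 : F) ≠ 0) {E : IntermediateField K (HahnSeries ℤ F)}
    {g : (F ≃ₐ[K] F) × ℤˣ} (hres : ∀ r ∈ residueSubfield E, g.1 r = r)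
    {x y : HahnSeries ℤ F} (hxE : x ∈ E) (hyE : y ∈ E) (hx0 : x ≠ 0) (hy0 : y ≠ 0)
    (hodd : Odd x.order) (hx : laurentTwist g x = x) (hy : laurentTwist g y = -y) : False := by
  set w := y ^ x.order * (x ^ y.order)⁻¹ with hw
  have hw0 : w ≠ 0 := mul_ne_zero (zpow_ne_zero _ hy0) (inv_ne_zero (zpow_ne_zero _ hx0))
  have hword : w.order = 0 := by
    rw [hw, order_mul (zpow_ne_zero _ hy0) (inv_ne_zero (zpow_ne_zero _ hx0)),
      order_inv_of_ne_zero (zpow_ne_zero _ hx0), order_zpow_of_ne_zero hy0,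
      order_zpow_of_ne_zero hx0]
    ring
  have hwE : w ∈ E := mul_mem (zpow_mem hyE _) (inv_mem (zpow_mem hxE _))
  have hgw : laurentTwist g w = -w := by
    rw [hw, map_mul, map_inv₀, map_zpow₀, map_zpow₀, hx, hy, hodd.neg_zpow, neg_mul]
  have hcoeff := hres _ (coeff_zero_mem_residueSubfield hwE hword.ge)
  have h := congrArg (fun v => HahnSeries.coeff v 0) hgw
  simp only [laurentTwist_coeff, hcoeff, zpow_zero, Units.val_one, Int.cast_one, one_mul,
    coeff_neg] at h
  have hne : w.coeff 0 ≠ 0 := by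
    rw [← hword]
    exact coeff_order_eq_zero.not.2 hw0
  exact mul_ne_zero h2 hne (by linear_combination h)

theorem eq_one_of_trivial_on_residueSubfield (h2 : (2 : F) ≠ 0)
    {E : IntermediateField K (HahnSeries ℤ F)} {h : F ≃ₐ[K] F}
    (hstab : ∀ ε : ℤˣ, ∀ x ∈ E, laurentTwist (h, ε) x ∈ E)
    (hstab' : ∀ x ∈ E, laurentTwist ((1 : F ≃ₐ[K] F), (-1 : ℤˣ)) x ∈ E)
    (hfaith : ∀ ε : ℤˣ, h ≠ 1 → ∃ x ∈ E, laurentTwist (h, ε) x ≠ x)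
    (hfaith' : ∃ x ∈ E, laurentTwist ((1 : F ≃ₐ[K] F), (-1 : ℤˣ)) x ≠ x)
    (hhh : h * h = 1) (hres : ∀ r ∈ residueSubfield E, h r = r) : h = 1 := by
  by_contra hne
  set z : HahnSeries ℤ F ≃ₐ[K] HahnSeries ℤ F := laurentTwist ((1 : F ≃ₐ[K] F), (-1 : ℤˣ)) with hz
  set a : HahnSeries ℤ F ≃ₐ[K] HahnSeries ℤ F := laurentTwist (h, (1 : ℤˣ)) with ha
  have hza (x : HahnSeries ℤ F) : z (a x) = a (z x) := by
    rw [hz, ha, ← AlgEquiv.mul_apply, ← AlgEquiv.mul_apply, ← map_mul, ← map_mul]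
    simp
  have haz (x : HahnSeries ℤ F) : laurentTwist (h, (-1 : ℤˣ)) x = a (z x) := by
    rw [hz, ha, ← AlgEquiv.mul_apply, ← map_mul]
    simp
  have haa (x : HahnSeries ℤ F) : a (a x) = x := by
    rw [ha, ← AlgEquiv.mul_apply, ← map_mul, Prod.mk_mul_mk, hhh, mul_one, ← Prod.one_eq_mk,
      map_one, AlgEquiv.one_apply]
  obtain ⟨x₀, hx₀E, hx₀0, hx₀⟩ := exists_twist_eq_neg (by simp) hstab' hfaith'
  have hx₀' : z x₀ = -x₀ := hx₀
  by_cases hax : x₀ + a x₀ = 0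
  · have hax' : a x₀ = -x₀ := (neg_eq_of_add_eq_zero_right hax).symm
    obtain ⟨y, hyE, hy0, hy⟩ := exists_twist_eq_neg (g := (h, -1)) (by simp [hhh])
      (hstab (-1)) (hfaith (-1) hne)
    exact twist_contradiction h2 (g := (h, -1)) hres hx₀E hyE hx₀0 hy0
      (odd_order_of_twist_eq_neg h2 hx₀0 hx₀) (by rw [haz, hx₀', map_neg, hax', neg_neg]) hy
  · obtain ⟨y, hyE, hy0, hy⟩ := exists_twist_eq_neg (g := (h, 1)) (by simp [hhh])
      (hstab 1) (hfaith 1 hne)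
    refine twist_contradiction h2 (g := (h, 1)) hres (add_mem hx₀E (hstab 1 _ hx₀E)) hyE hax hy0
      (odd_order_of_twist_eq_neg (K := K) h2 hax ?_) ?_ hy
    · change z (x₀ + a x₀) = -(x₀ + a x₀)
      rw [map_add, hza, hx₀', map_neg, neg_add]
    · change a (x₀ + a x₀) = x₀ + a x₀
      rw [map_add, haa, add_comm]

theorem residueSubfield_faithful (h2 : (2 : F) ≠ 0) {H : Type*} [Group H]
    (hH : ∀ N : Subgroup H, N.Normal → (∀ h ∈ N, h * h = 1 → h = 1) → N = ⊥)
    {τ : H →* (F ≃ₐ[K] F)} (hτ : Function.Injective τ) {E : IntermediateField K (HahnSeries ℤ F)}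
    (hstab : ∀ h : H, ∀ ε : ℤˣ, ∀ x ∈ E, laurentTwist (τ h, ε) x ∈ E)
    (hfaith : ∀ h : H, ∀ ε : ℤˣ, (h, ε) ≠ 1 → ∃ x ∈ E, laurentTwist (τ h, ε) x ≠ x) :
    (∀ h : H, ∀ r ∈ residueSubfield E, τ h r ∈ residueSubfield E) ∧
      (∀ h : H, h ≠ 1 → ∃ r ∈ residueSubfield E, τ h r ≠ r) ∧
      Algebra.trdeg K (residueSubfield E) + 1 ≤ Algebra.trdeg K E := by
  have hmul (h h' : H) (x : F) : τ (h * h') x = τ h (τ h' x) := by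
    rw [map_mul, AlgEquiv.mul_apply]
  have hres (h : H) (r : F) (hr : r ∈ residueSubfield E) : τ h r ∈ residueSubfield E :=
    residueSubfield_stable (hstab h 1) hr
  have hneg := hstab 1 (-1)
  have hneg' := hfaith 1 (-1) (by simp [Prod.ext_iff])
  rw [map_one] at hneg hneg'
  refine ⟨hres, ?_, ?_⟩
  · let N : Subgroup H :=
      { carrier := {h | ∀ r ∈ residueSubfield E, τ h r = r}
        mul_mem' := fun {a b} ha hb r hr => by rw [hmul, hb r hr, ha r hr]
        one_mem' := fun r _ => by rw [map_one, AlgEquiv.one_apply]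
        inv_mem' := fun {a} ha r hr => by
          rw [← ha _ (hres a⁻¹ r hr), ← hmul, mul_inv_cancel, map_one, AlgEquiv.one_apply] }
    have hN : N = ⊥ := by
      refine hH N ⟨fun n hn g r hr => ?_⟩ fun h hh hhh => hτ ?_
      · rw [hmul, hmul, hn _ (hres g⁻¹ r hr), ← hmul, mul_inv_cancel, map_one, AlgEquiv.one_apply]
      · rw [map_one]
        refine eq_one_of_trivial_on_residueSubfield h2 (hstab h) hneg
          (fun ε hne => hfaith h ε fun h0 => hne ?_) hneg' ?_ hh
        · exact (congrArg τ (congrArg Prod.fst h0)).trans (map_one τ)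
        · rw [← map_mul, hhh, map_one]
    intro h hh
    by_contra! hall
    exact hh (Subgroup.mem_bot.1 (hN ▸ (show h ∈ N from hall)))
  · obtain ⟨x, hx, hx0, hxx⟩ := exists_twist_eq_neg (by simp) hneg hneg'
    refine trdeg_residueSubfield_add_one_le hx hx0 fun h => ?_
    have := odd_order_of_twist_eq_neg h2 hx0 hxx
    rw [h] at this
    exact absurd this (by decide)

end Residue

section Equivariance

universe u

variable {K : Type u} [Field K] {G : Type}

variable {L : Type u} [Field L] [Algebra K L]

/-- The graph of the specialization of the elements of `E` along `φ`, where it is defined. -/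
def specializationGraph (φ : MvPolynomial G K →ₐ[K] L) (E : IntermediateField K (FnField K G)) :
    Subalgebra K (FnField K G × L) where
  carrier := {x | x.1 ∈ E ∧ ∃ p q, φ q ≠ 0 ∧ x.1 * algebraMap _ _ q = algebraMap _ _ p ∧
    x.2 * φ q = φ p}
  mul_mem' := by
    rintro ⟨a, b⟩ ⟨a', b'⟩ ⟨ha, p, q, hq, h1, h2⟩ ⟨ha', p', q', hq', h1', h2'⟩
    refine ⟨mul_mem ha ha', p * p', q * q', ?_, ?_, ?_⟩
    · rw [map_mul]
      exact mul_ne_zero hq hq'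
    · simp only [Prod.mk_mul_mk, map_mul] at *
      rw [← h1, ← h1']
      ring
    · simp only [Prod.mk_mul_mk, map_mul] at *
      rw [← h2, ← h2']
      ring
  add_mem' := by
    rintro ⟨a, b⟩ ⟨a', b'⟩ ⟨ha, p, q, hq, h1, h2⟩ ⟨ha', p', q', hq', h1', h2'⟩
    refine ⟨add_mem ha ha', p * q' + p' * q, q * q', ?_, ?_, ?_⟩
    · rw [map_mul]
      exact mul_ne_zero hq hq'
    · simp only [Prod.mk_add_mk, map_mul, map_add] at *
      rw [← h1, ← h1']
      ring
    · simp only [Prod.mk_add_mk, map_mul, map_add] at *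
      rw [← h2, ← h2']
      ring
  algebraMap_mem' r := by
    refine ⟨E.algebraMap_mem r, algebraMap _ _ r, 1, ?_, ?_, ?_⟩
    · simp
    · rw [map_one, mul_one]
      exact IsScalarTower.algebraMap_apply K (MvPolynomial G K) (FnField K G) r
    · rw [map_one, mul_one, AlgHom.commutes]
      rfl

theorem trdeg_map_specializationGraph_le (φ : MvPolynomial G K →ₐ[K] L)
    (E : IntermediateField K (FnField K G)) :
    Algebra.trdeg K ((specializationGraph φ E).map (AlgHom.snd K _ L)) ≤ Algebra.trdeg K E := by
  let f : specializationGraph φ E →ₐ[K] E :=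
    ((AlgHom.fst K _ L).comp (specializationGraph φ E).val).codRestrict E.toSubalgebra
      fun x => x.2.1
  have hf : Function.Injective f := by
    refine (injective_iff_map_eq_zero f).2 ?_
    rintro ⟨⟨a, b⟩, ha, p, q, hq, h1, h2⟩ h
    have ha0 : a = 0 := congrArg Subtype.val h
    simp only at h1 h2
    have hp : p = 0 := by
      refine (IsFractionRing.injective (MvPolynomial G K) (FnField K G)) ?_
      rw [← h1, ha0, zero_mul, map_zero]
    have hb : b = 0 := by
      rw [hp, map_zero] at h2
      exact (mul_eq_zero.1 h2).resolve_right hq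
    exact Subtype.ext (Prod.ext ha0 hb)
  have : Nontrivial (specializationGraph φ E) := inferInstance
  refine le_trans (trdeg_le_of_surjective (R := K) (A := specializationGraph φ E)
    (((AlgHom.snd K _ L).comp (specializationGraph φ E).val).codRestrict _
      fun x => ⟨x, x.2, rfl⟩) ?_) (trdeg_le_of_injective f hf)
  rintro ⟨_, x, hx, rfl⟩
  exact ⟨⟨x, hx⟩, rfl⟩

variable [Group G]

theorem galAction_algebraMap (g : G) (p : MvPolynomial G K) :
    galAction K G g (algebraMap _ _ p) = algebraMap _ _ (MvPolynomial.rename (g * ·) p) :=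
  IsFractionRing.fieldEquivOfAlgEquiv_algebraMap _ _ _ _ _

theorem galAction_injective : Function.Injective (galAction K G) := by
  intro g h hgh
  have := DFunLike.congr_fun hgh (algebraMap (MvPolynomial G K) _ (MvPolynomial.X 1))
  rw [galAction_algebraMap, galAction_algebraMap] at this
  have := IsFractionRing.injective (MvPolynomial G K) (FnField K G) this
  simpa using this

theorem exists_specialization {Γ : Type*} [Group Γ] [Finite Γ] [Finite G] [Infinite L]
    {ι : Γ →* G} (hι : Function.Injective ι) {ρ : Γ →* (L ≃ₐ[K] L)} (hρ : Function.Injective ρ)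
    {E : IntermediateField K (FnField K G)} (hstab : ∀ g : G, ∀ x ∈ E, galAction K G g x ∈ E)
    (hfaith : ∀ g : G, g ≠ 1 → ∃ x ∈ E, galAction K G g x ≠ x) :
    ∃ E' : IntermediateField K L, (∀ γ, ∀ x ∈ E', ρ γ x ∈ E') ∧
      (∀ γ, γ ≠ 1 → ∃ x ∈ E', ρ γ x ≠ x) ∧ Algebra.trdeg K E' ≤ Algebra.trdeg K E := by
  classical
  have := Fintype.ofFinite Γ
  have hmove (γ : Γ) : ∃ p q : MvPolynomial G K, q ≠ 0 ∧ (γ ≠ 1 →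
      algebraMap _ (FnField K G) p / algebraMap _ _ q ∈ E ∧
      MvPolynomial.rename (ι γ * ·) p * q - p * MvPolynomial.rename (ι γ * ·) q ≠ 0) := by
    by_cases hγ : γ = 1
    · exact ⟨0, 1, one_ne_zero, fun h => absurd hγ h⟩
    obtain ⟨x, hx, hne⟩ := hfaith (ι γ) (fun h => hγ (hι (h.trans (map_one ι).symm)))
    obtain ⟨p, q, hq, rfl⟩ := IsFractionRing.div_surjective (A := MvPolynomial G K) x
    refine ⟨p, q, nonZeroDivisors.ne_zero hq, fun _ => ⟨hx, fun h => hne ?_⟩⟩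
    rw [map_div₀, galAction_algebraMap, galAction_algebraMap, div_eq_div_iff, ← map_mul, ← map_mul,
      sub_eq_zero.1 h]
    · rw [map_ne_zero_iff _ (IsFractionRing.injective _ _),
        map_ne_zero_iff _ (MvPolynomial.rename_injective _ (mul_right_injective _))]
      exact nonZeroDivisors.ne_zero hq
    · rw [map_ne_zero_iff _ (IsFractionRing.injective _ _)]
      exact nonZeroDivisors.ne_zero hq
  choose p q hq0 hpq using hmove
  obtain ⟨u, hu, hu0⟩ := exists_equivariant_aeval_ne_zero ι ρ hρ
    (f := ∏ γ ∈ Finset.univ.erase 1, q γ * (MvPolynomial.rename (ι γ * ·) (p γ) * q γ -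
      p γ * MvPolynomial.rename (ι γ * ·) (q γ)))
    (Finset.prod_ne_zero_iff.2 fun γ hγ => mul_ne_zero (hq0 γ) (hpq γ (Finset.mem_erase.1 hγ).1).2)
  have hφ (γ : Γ) (r : MvPolynomial G K) :
      MvPolynomial.aeval u (MvPolynomial.rename (ι γ * ·) r) = ρ γ (MvPolynomial.aeval u r) := by
    rw [MvPolynomial.aeval_rename]
    refine Eq.trans ?_ (MvPolynomial.comp_aeval_apply (f := u) (ρ γ : L →ₐ[K] L) r).symm
    congr 2
    funext g
    exact hu γ g
  set φ := MvPolynomial.aeval (R := K) u with hφdef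
  rw [map_prod, Finset.prod_ne_zero_iff] at hu0
  set C := (specializationGraph φ E).map (AlgHom.snd K _ L) with hC
  have hCstab (γ : Γ) {x : L} (hx : x ∈ C) : ρ γ x ∈ C := by
    obtain ⟨⟨a, b⟩, ⟨ha, r, s, hs, h1, h2⟩, rfl⟩ := hx
    refine ⟨(galAction K G (ι γ) a, ρ γ b), ⟨hstab _ _ ha, MvPolynomial.rename (ι γ * ·) r,
      MvPolynomial.rename (ι γ * ·) s, ?_, ?_, ?_⟩, rfl⟩
    · rwa [hφ, map_ne_zero_iff _ (ρ γ).injective]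
    · rw [← galAction_algebraMap, ← galAction_algebraMap, ← map_mul]
      exact congrArg _ h1
    · rw [hφ, hφ, ← map_mul]
      exact congrArg _ h2
  refine ⟨IntermediateField.adjoin K C, fun γ x hx => ?_, fun γ hγ => ?_, ?_⟩
  · have : IntermediateField.adjoin K (C : Set L) ≤
        (IntermediateField.adjoin K (C : Set L)).comap (ρ γ : L →ₐ[K] L) :=
      IntermediateField.adjoin_le_iff.2 fun y hy =>
        IntermediateField.subset_adjoin K (C : Set L) (hCstab γ hy)
    exact this hx
  · have h0 := hu0 γ (Finset.mem_erase.2 ⟨hγ, Finset.mem_univ _⟩)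
    rw [map_mul, map_sub, map_mul, map_mul, hφ, hφ] at h0
    obtain ⟨hq, h0⟩ := mul_ne_zero_iff.1 h0
    refine ⟨φ (p γ) / φ (q γ), IntermediateField.subset_adjoin K (C : Set L)
      ⟨(algebraMap _ _ (p γ) / algebraMap _ _ (q γ), φ (p γ) / φ (q γ)),
      ⟨(hpq γ hγ).1, p γ, q γ, hq, ?_, ?_⟩, rfl⟩, fun h => h0 ?_⟩
    · refine div_mul_cancel₀ _ ?_
      rw [map_ne_zero_iff _ (IsFractionRing.injective _ _)]
      exact hq0 γ
    · exact div_mul_cancel₀ _ hq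
    · rw [map_div₀, div_eq_div_iff ((map_ne_zero_iff _ (ρ γ).injective).2 hq) hq] at h
      exact sub_eq_zero.2 h
  · rw [trdeg_intermediateField_adjoin, Algebra.adjoin_eq]
    exact trdeg_map_specializationGraph_le φ E

end Equivariance

section EssentialDimension

universe u

variable {K : Type u} [Field K]

theorem trdeg_fnField_lt_aleph0 (σ : Type) [Finite σ] :
    Algebra.trdeg K (FnField K σ) < Cardinal.aleph0 := by
  have := (IsFractionRing.comap_isAlgebraic_iff (A := MvPolynomial σ K) (K := FnField K σ)
    (C := FnField K σ)).2 inferInstance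
  have h : Algebra.trdeg K (FnField K σ) = Algebra.trdeg K (MvPolynomial σ K) := by
    rw [← _root_.trdeg_add_eq K (MvPolynomial σ K), trdeg_eq_zero (R := MvPolynomial σ K), add_zero]
  rw [h, MvPolynomial.trdeg_of_isDomain]
  simp

theorem exists_trdeg_eq_edK (G : Type) [Group G] [Finite G] :
    ∃ E : IntermediateField K (FnField K G), (∀ g : G, ∀ x ∈ E, galAction K G g x ∈ E) ∧
      (∀ g : G, g ≠ 1 → ∃ x ∈ E, galAction K G g x ≠ x) ∧ Algebra.trdeg K E = edK K G := by
  refine Nat.sInf_mem (s := { d : ℕ | ∃ E : IntermediateField K (FnField K G),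
    (∀ g : G, ∀ x ∈ E, galAction K G g x ∈ E) ∧
    (∀ g : G, g ≠ 1 → ∃ x ∈ E, galAction K G g x ≠ x) ∧ trdeg K E = d }) ?_
  have hlt : Algebra.trdeg K (⊤ : IntermediateField K (FnField K G)) < Cardinal.aleph0 :=
    (trdeg_le_of_injective (⊤ : IntermediateField K (FnField K G)).val
      Subtype.val_injective).trans_lt (trdeg_fnField_lt_aleph0 G)
  obtain ⟨d, hd⟩ := Cardinal.lt_aleph0.1 hlt
  refine ⟨d, ⊤, fun _ _ _ => trivial, fun g hg => ?_, hd⟩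
  by_contra! h
  exact hg (galAction_injective (K := K) (by ext x; simpa using h x trivial))

theorem edK_le {G : Type} [Group G] {E : IntermediateField K (FnField K G)}
    (hstab : ∀ g : G, ∀ x ∈ E, galAction K G g x ∈ E)
    (hfaith : ∀ g : G, g ≠ 1 → ∃ x ∈ E, galAction K G g x ≠ x) {d : ℕ}
    (hd : Algebra.trdeg K E ≤ d) : edK K G ≤ d := by
  obtain ⟨d', hd'⟩ := Cardinal.lt_aleph0.1 (hd.trans_lt (Cardinal.natCast_lt_aleph0 (n := d)))
  rw [hd', Nat.cast_le] at hd
  refine le_trans ?_ hd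
  unfold edK
  exact Nat.sInf_le ⟨E, hstab, hfaith, hd'⟩

theorem two_ne_zero_of_ringChar_ne (hchar : ringChar K ≠ 2) (F : Type*) [Field F] [Algebra K F] :
    (2 : F) ≠ 0 := by
  have := (map_ne_zero (algebraMap K F)).2 (Ring.two_ne_zero hchar)
  rwa [map_ofNat] at this

theorem edK_add_one_le (hchar : ringChar K ≠ 2) {G H : Type} [Group G] [Group H] [Finite G]
    {ι : H × ℤˣ →* G} (hι : Function.Injective ι)
    (hH : ∀ N : Subgroup H, N.Normal → (∀ h ∈ N, h * h = 1 → h = 1) → N = ⊥) :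
    edK K H + 1 ≤ edK K G := by
  have h2 := two_ne_zero_of_ringChar_ne hchar (FnField K H)
  have : Finite (H × ℤˣ) := Finite.of_injective ι hι
  have : Infinite (HahnSeries ℤ (FnField K H)) :=
    Infinite.of_injective (fun n : ℤ => HahnSeries.single n (1 : FnField K H)) fun m n h => by
      have := congrArg HahnSeries.order h
      simpa using this
  let ρ : H × ℤˣ →* (HahnSeries ℤ (FnField K H) ≃ₐ[K] HahnSeries ℤ (FnField K H)) :=
    laurentTwist.comp ((galAction K H).prodMap (MonoidHom.id ℤˣ))
  have hρ : Function.Injective ρ := (laurentTwist_injective h2).comp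
    (galAction_injective.prodMap Function.injective_id)
  obtain ⟨E, hstab, hfaith, hE⟩ := exists_trdeg_eq_edK (K := K) G
  obtain ⟨E', hstab', hfaith', hE'⟩ := exists_specialization hι hρ hstab hfaith
  obtain ⟨hres, hfaith'', hdim⟩ := residueSubfield_faithful h2 hH galAction_injective
    (fun h ε => hstab' (h, ε)) (fun h ε => hfaith' (h, ε))
  replace hdim := hdim.trans (hE'.trans hE.le)
  obtain ⟨d, hd⟩ := Cardinal.lt_aleph0.1
    ((le_self_add.trans hdim).trans_lt (Cardinal.natCast_lt_aleph0 (n := edK K G)))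
  rw [hd] at hdim
  exact (Nat.add_le_add_right (edK_le hres hfaith'' hd.le) 1).trans (by exact_mod_cast hdim)

end EssentialDimension

section SymmetricGroup

open Equiv

theorem Equiv.Perm.normal_eq_bot_of_forall_involution {α : Type*} [Fintype α] [DecidableEq α]
    (hα : Fintype.card α ≠ 3) {N : Subgroup (Perm α)} [N.Normal]
    (hN : ∀ σ ∈ N, σ * σ = 1 → σ = 1) : N = ⊥ := by
  rw [Subgroup.eq_bot_iff_forall]
  intro σ hσ
  by_contra hne
  obtain ⟨a, ha⟩ : ∃ a, σ a ≠ a := by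
    by_contra! h
    exact hne (Perm.ext h)
  by_cases hc : Fintype.card α ≤ 2
  · refine hne (hN σ hσ (Perm.ext fun x => ?_))
    by_contra hx
    have h1 : σ x ≠ x := fun h => hx (by simp [h])
    have : ({x, σ x, σ (σ x)} : Finset α).card = 3 := by
      rw [Finset.card_eq_three]
      exact ⟨_, _, _, h1.symm, fun h => hx h.symm, fun h => h1 (σ.injective h).symm, rfl⟩
    have := Finset.card_le_univ ({x, σ x, σ (σ x)} : Finset α)
    omega
  have fresh (s : Finset α) (hs : s.card ≤ 3) : ∃ c, c ∉ s := by
    by_contra! h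
    have := Finset.card_le_card (show Finset.univ ⊆ s from fun x _ => h x)
    rw [Finset.card_univ] at this
    omega
  have hdouble (x y z w : α) (hzw : z ≠ w) (hzx : z ≠ x) (hzy : z ≠ y) (hwx : w ≠ x) (hwy : w ≠ y)
      (h : swap x y * swap z w ∈ N) : False := by
    have hcomm : swap x y * swap z w = swap z w * swap x y := by
      rw [mul_swap_eq_swap_mul, swap_apply_of_ne_of_ne hzx hzy, swap_apply_of_ne_of_ne hwx hwy]
    have h1 := hN _ h (by
      nth_rewrite 2 [hcomm]
      rw [mul_assoc, swap_mul_self_mul, swap_mul_self])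
    have h2 := Perm.congr_fun h1 z
    rw [Perm.mul_apply, swap_apply_left, swap_apply_of_ne_of_ne hwx hwy] at h2
    exact hzw h2.symm
  have hthree (x y z : α) (hxy : x ≠ y) (hxz : x ≠ z) (hyz : y ≠ z)
      (h : swap x y * swap x z ∈ N) : False := by
    obtain ⟨w, hw⟩ := fresh {x, y, z} Finset.card_le_three
    simp only [Finset.mem_insert, Finset.mem_singleton, not_or] at hw
    obtain ⟨hwx, hwy, hwz⟩ := hw
    have hconj : swap x y * swap x w ∈ N := by
      have h1 := Subgroup.Normal.conj_mem inferInstance _ h (swap z w)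
      rwa [mul_assoc, mul_assoc, swap_inv, ← mul_assoc, ← mul_assoc,
        mul_swap_eq_swap_mul (swap z w),
        mul_assoc (swap _ _), mul_swap_eq_swap_mul (swap z w), mul_assoc, mul_assoc, swap_mul_self,
        mul_one, swap_apply_left, swap_apply_of_ne_of_ne hxz (Ne.symm hwx),
        swap_apply_of_ne_of_ne hyz (Ne.symm hwy)] at h1
    refine hdouble y z x w (Ne.symm hwx) hxy hxz hwy hwz ?_
    have h1 := mul_mem h hconj
    rwa [mul_swap_eq_swap_mul (swap x y) x z, swap_apply_left,
      swap_apply_of_ne_of_ne hxz.symm hyz.symm, mul_assoc, swap_mul_self_mul] at h1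
  obtain ⟨c, hc⟩ := fresh {a, σ a} (Finset.card_le_two.trans (by norm_num))
  simp only [Finset.mem_insert, Finset.mem_singleton, not_or] at hc
  obtain ⟨hca, hcb⟩ := hc
  have hκ : swap (σ a) (σ c) * swap a c ∈ N := by
    have h1 := mul_mem hσ (Subgroup.Normal.conj_mem inferInstance _ (inv_mem hσ) (swap a c))
    rwa [swap_inv, ← mul_assoc, ← mul_assoc, mul_swap_eq_swap_mul σ, mul_inv_cancel_right] at h1
  by_cases h1 : σ c = a
  · rw [h1, swap_comm] at hκ
    exact hthree a (σ a) c (Ne.symm ha) (Ne.symm hca) (Ne.symm hcb) hκ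
  by_cases h2 : σ c = c
  · rw [h2, swap_comm, swap_comm a] at hκ
    exact hthree c (σ a) a hcb hca ha hκ
  exact hdouble (σ a) (σ c) a c (Ne.symm hca) (Ne.symm ha) (Ne.symm h1) hcb (Ne.symm h2) hκ

end SymmetricGroup

section SymmetricGroupDimension

open Equiv MvPolynomial

universe u

theorem exists_perm_prod_units_injective {m n : ℕ} (hmn : m ≤ n) :
    ∃ ι : Perm (Fin m) × ℤˣ →* Perm (Fin (n + 2)), Function.Injective ι := by
  have hsign : Function.Bijective (Perm.sign : Perm (Fin 2) →* ℤˣ) := by decide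
  have e : Fin m ⊕ Fin 2 ↪ Fin (n + 2) :=
    finSumFinEquiv.toEmbedding.trans (Fin.castLEEmb (by omega))
  let s := (MulEquiv.ofBijective (Perm.sign : Perm (Fin 2) →* ℤˣ) hsign).symm
  let f : Perm (Fin m) × ℤˣ →* Perm (Fin m) × Perm (Fin 2) :=
    (MonoidHom.id _).prodMap s.toMonoidHom
  have hf : Function.Injective f := Function.injective_id.prodMap s.injective
  refine ⟨(Perm.viaEmbeddingHom e).comp ((Perm.sumCongrHom (Fin m) (Fin 2)).comp f), ?_⟩
  exact (Perm.viaEmbeddingHom_injective e).comp (Perm.sumCongrHom_injective.comp hf)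

variable {K : Type u} [Field K]

theorem edK_perm_add_one_le (hchar : ringChar K ≠ 2) {m n : ℕ} (hm : m ≠ 3) (hmn : m ≤ n) :
    edK K (Perm (Fin m)) + 1 ≤ edK K (Perm (Fin (n + 2))) := by
  obtain ⟨ι, hι⟩ := exists_perm_prod_units_injective hmn
  exact edK_add_one_le hchar hι fun N _ hN =>
    Perm.normal_eq_bot_of_forall_involution (by simpa using hm) hN

theorem trdeg_adjoin_singleton_le_one {L : Type u} [Field L] [Algebra K L] (x : L) :
    Algebra.trdeg K (IntermediateField.adjoin K {x}) ≤ 1 := by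
  rw [trdeg_intermediateField_adjoin, Algebra.adjoin_singleton_eq_range_aeval,
    ← Polynomial.trdeg_of_isDomain (R := K)]
  exact trdeg_le_of_surjective _ (Polynomial.aeval x).rangeRestrict_surjective

variable (K) in
/-- The sum of the variables indexed by the permutations sending `0` to `i`. -/
def fiberSum (i : Fin 3) : MvPolynomial (Perm (Fin 3)) K := ∑ g, if g 0 = i then X g else 0

theorem rename_fiberSum (σ : Perm (Fin 3)) (i : Fin 3) :
    rename (σ * ·) (fiberSum K i) = fiberSum K (σ i) := by
  rw [fiberSum, fiberSum, map_sum]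
  refine Fintype.sum_equiv (Equiv.mulLeft σ) _ _ fun g => ?_
  by_cases hi : g 0 = i <;> simp [hi]

theorem exists_eval_fiberSum (t : Fin 3 → K) : ∃ p, ∀ i, eval p (fiberSum K i) = t i := by
  refine ⟨fun g => if g = swap 0 (g 0) then t (g 0) else 0, fun i => ?_⟩
  rw [fiberSum, map_sum, Finset.sum_eq_single (swap 0 i)]
  · simp
  · intro g _ hg
    by_cases hi : g 0 = i
    · simp [hi, hg]
    · simp [hi]
  · simp

theorem edK_perm_three_le_one : edK K (Perm (Fin 3)) ≤ 1 := by
  let y (i : Fin 3) : FnField K (Perm (Fin 3)) := algebraMap _ _ (fiberSum K i)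
  have hy (σ : Perm (Fin 3)) (i : Fin 3) : galAction K _ σ (y i) = y (σ i) := by
    rw [galAction_algebraMap, rename_fiberSum]
  have hinj : Function.Injective (algebraMap (MvPolynomial (Perm (Fin 3)) K)
    (FnField K (Perm (Fin 3)))) := IsFractionRing.injective _ _
  have hyne {i j : Fin 3} (hij : i ≠ j) : y i - y j ≠ 0 := by
    intro h
    obtain ⟨p, hp⟩ := exists_eval_fiberSum (K := K) (Pi.single i 1)
    have := congrArg (eval p) (hinj (sub_eq_zero.1 h))
    rw [hp, hp, Pi.single_eq_same, Pi.single_eq_of_ne hij.symm] at this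
    exact one_ne_zero this
  set u := (y 0 - y 2) / (y 1 - y 2) with hu
  have hσu (σ : Perm (Fin 3)) :
      galAction K _ σ u = (y (σ 0) - y (σ 2)) / (y (σ 1) - y (σ 2)) := by
    rw [hu, map_div₀, map_sub, map_sub, hy, hy, hy]
  have huE : u ∈ IntermediateField.adjoin K {u} := IntermediateField.mem_adjoin_simple_self K u
  have hstab (σ : Perm (Fin 3)) : galAction K _ σ u ∈ IntermediateField.adjoin K {u} := by
    have hv (i : Fin 3) : (y i - y 2) / (y 1 - y 2) ∈ IntermediateField.adjoin K {u} := by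
      fin_cases i
      · exact huE
      · exact (div_self (hyne (by decide : (1 : Fin 3) ≠ 2))).symm ▸ one_mem _
      · simp
    rw [hσu, ← sub_sub_sub_cancel_right (y (σ 0)) _ (y 2),
      ← sub_sub_sub_cancel_right (y (σ 1)) _ (y 2),
      ← div_div_div_cancel_right₀ (hyne (by decide : (1 : Fin 3) ≠ 2)),
      sub_div (_ - _), sub_div (_ - _) (_ - _) (y 1 - y 2)]
    exact div_mem (sub_mem (hv _) (hv _)) (sub_mem (hv _) (hv _))
  refine edK_le (E := IntermediateField.adjoin K {u}) (fun σ x hx => ?_) (fun σ hσ => ?_)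
    (by simpa using trdeg_adjoin_singleton_le_one u)
  · have : IntermediateField.adjoin K {u} ≤
        (IntermediateField.adjoin K {u}).comap (galAction K _ σ : _ →ₐ[K] _) :=
      IntermediateField.adjoin_le_iff.2 (Set.singleton_subset_iff.2 (hstab σ))
    exact this hx
  · refine ⟨u, huE, fun h => ?_⟩
    rw [hσu, hu, div_eq_div_iff (hyne (σ.injective.ne (by decide))) (hyne (by decide))] at h
    simp only [y, ← map_sub, ← map_mul] at h
    have ht (t : Fin 3 → K) :
        (t (σ 0) - t (σ 2)) * (t 1 - t 2) = (t 0 - t 2) * (t (σ 1) - t (σ 2)) := by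
      obtain ⟨p, hp⟩ := exists_eval_fiberSum t
      simpa [hp] using congrArg (eval p) (hinj h)
    have h1 := ht (Pi.single 1 1)
    have h2 := ht (Pi.single 2 1)
    have hcases : ∀ σ : Perm (Fin 3), σ ≠ 1 →
        (σ 0 = 1 ∧ σ 2 ≠ 1) ∨ (σ 0 ≠ 1 ∧ σ 2 = 1) ∨
        (σ 0 = 2 ∧ σ 1 ≠ 2 ∧ σ 2 ≠ 2) ∨ (σ 0 ≠ 2 ∧ σ 1 = 2 ∧ σ 2 ≠ 2) := by
      decide
    rcases hcases σ hσ with h | h | h | h <;> simp [Pi.single_apply, h] at h1 h2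

end SymmetricGroupDimension

/-- If `char K ≠ 2`, then `ed_K(S_{n+2}) ≥ ed_K(Sₙ) + 1` for every `n ≥ 1`, and
consequently `ed_K(Sₙ) ≥ ⌊n/2⌋` for every `n ≥ 1`. -/
theorem edK_symmGroup_lower (K : Type*) [Field K] (hchar : ringChar K ≠ 2) :
    (∀ n : ℕ, 1 ≤ n → edK K (Equiv.Perm (Fin n)) + 1 ≤ edK K (Equiv.Perm (Fin (n + 2)))) ∧
    (∀ n : ℕ, 1 ≤ n → n / 2 ≤ edK K (Equiv.Perm (Fin n))) := by
  have hstep (n : ℕ) : edK K (Equiv.Perm (Fin n)) + 1 ≤ edK K (Equiv.Perm (Fin (n + 2))) := by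
    by_cases hn : n = 3
    · subst hn
      change _ ≤ edK K (Equiv.Perm (Fin 5))
      have h0 : edK K (Equiv.Perm (Fin 0)) + 1 ≤ edK K (Equiv.Perm (Fin 2)) :=
        edK_perm_add_one_le hchar (m := 0) (n := 0) (by norm_num) le_rfl
      have h2 : edK K (Equiv.Perm (Fin 2)) + 1 ≤ edK K (Equiv.Perm (Fin 5)) :=
        edK_perm_add_one_le hchar (m := 2) (n := 3) (by norm_num) (by norm_num)
      have h3 := edK_perm_three_le_one (K := K)
      omega
    · exact edK_perm_add_one_le hchar hn le_rfl
  refine ⟨fun n _ => hstep n, fun n _ => ?_⟩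
  induction n using Nat.twoStepInduction with
  | zero => simp
  | one => simp
  | more n ih _ =>
    have := hstep n
    rcases Nat.eq_zero_or_pos n with rfl | hn
    · omega
    · have := ih hn
      omega
end
end
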